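/- arXiv:2007.10108 — 2 statements merged into one kernel-verified Lean document; each statement's English description precedes it below -/
import Mathlib

section
/- Let V be in the class 𝒞 and set I := (V'_-, V'_+) ⊂ ℝ. Then for every λ ∈ I the integrals ∫_ℝ e^{−V(u)+λu} du and ∫_ℝ |u| e^{−V(u)+λu} du are finite, the function ψ : I → ℝ defined by ψ(λ) = (∫_ℝ u·e^{−V(u)+λu} du)/(∫_ℝ e^{−V(u)+λu} du) is strictly increasing, and ψ is a bijection from I onto ℝ. -/
open MeasureTheory Filter Real

noncomputable section

/-- The class 𝒞 of potentials: convex, at most polynomial growth, non-affine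
(the asymptotic slopes at `+∞` and `-∞`, taken in the extended reals, differ). -/
structure InClassC (V : ℝ → ℝ) : Prop where
  convex : ConvexOn ℝ Set.univ V
  growth : ∃ C > (0 : ℝ), ∃ K : ℝ, 1 ≤ K ∧ ∀ x : ℝ, |V x| ≤ C * (1 + |x|) ^ K
  slopes : ∃ vm vp : EReal,
    Tendsto (fun x : ℝ => ((V x / x : ℝ) : EReal)) atBot (nhds vm) ∧
    Tendsto (fun x : ℝ => ((V x / x : ℝ) : EReal)) atTop (nhds vp) ∧
    vm < vp


lemma tmb_integrable_exp (V : ℝ → ℝ) (hc : Continuous V) (vm vp : EReal)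
    (hm : Tendsto (fun x : ℝ => ((V x / x : ℝ) : EReal)) atBot (nhds vm))
    (hp : Tendsto (fun x : ℝ => ((V x / x : ℝ) : EReal)) atTop (nhds vp))
    (l : ℝ) (h1 : vm < (l : EReal)) (h2 : (l : EReal) < vp) :
    Integrable (fun u : ℝ => Real.exp (-(V u) + l * u)) := by
  obtain ⟨a, ha1, ha2⟩ := EReal.lt_iff_exists_real_btwn.1 h1
  obtain ⟨b, hb1, hb2⟩ := EReal.lt_iff_exists_real_btwn.1 h2
  have ha2' : a < l := by exact_mod_cast ha2
  have hb1' : l < b := by exact_mod_cast hb1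
  have hcont : Continuous (fun u : ℝ => Real.exp (-(V u) + l * u)) := by fun_prop
  refine hcont.locallyIntegrable.integrable_of_isBigO_atBot_atTop
    (g := fun u => Real.exp ((l - a) * u)) (g' := fun u => Real.exp ((l - b) * u)) ?_ ?_ ?_ ?_
  · refine Asymptotics.IsBigO.of_bound 1 ?_
    filter_upwards [hm.eventually_lt_const ha1, eventually_lt_atBot 0] with x hx hx0
    have hx' : V x / x < a := by exact_mod_cast hx
    rw [div_lt_iff_of_neg hx0] at hx'
    rw [one_mul, Real.norm_of_nonneg (Real.exp_pos _).le, Real.norm_of_nonneg (Real.exp_pos _).le]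
    apply Real.exp_le_exp.2; linarith
  · exact ⟨Set.Iic 0, Iic_mem_atBot 0, integrableOn_exp_mul_Iic (by linarith) 0⟩
  · refine Asymptotics.IsBigO.of_bound 1 ?_
    filter_upwards [hp.eventually_const_lt hb2, eventually_gt_atTop 0] with x hx hx0
    have hx' : b < V x / x := by exact_mod_cast hx
    rw [lt_div_iff₀ hx0] at hx'
    rw [one_mul, Real.norm_of_nonneg (Real.exp_pos _).le, Real.norm_of_nonneg (Real.exp_pos _).le]
    apply Real.exp_le_exp.2; linarith
  · exact ⟨Set.Ioi 0, Ioi_mem_atTop 0, integrableOn_exp_mul_Ioi (by linarith) 0⟩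

lemma tmb_integrable_abs (V : ℝ → ℝ) (hc : Continuous V) (vm vp : EReal)
    (hm : Tendsto (fun x : ℝ => ((V x / x : ℝ) : EReal)) atBot (nhds vm))
    (hp : Tendsto (fun x : ℝ => ((V x / x : ℝ) : EReal)) atTop (nhds vp))
    (l : ℝ) (h1 : vm < (l : EReal)) (h2 : (l : EReal) < vp) :
    Integrable (fun u : ℝ => |u| * Real.exp (-(V u) + l * u)) := by
  obtain ⟨a, ha1, ha2⟩ := EReal.lt_iff_exists_real_btwn.1 h1
  obtain ⟨b, hb1, hb2⟩ := EReal.lt_iff_exists_real_btwn.1 h2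
  have ha2' : a < l := by exact_mod_cast ha2
  have hb1' : l < b := by exact_mod_cast hb1
  have Ia := tmb_integrable_exp V hc vm vp hm hp a ha1 (ha2.trans h2)
  have Ib := tmb_integrable_exp V hc vm vp hm hp b (h1.trans hb1) hb2
  refine ((Ia.const_mul (l - a)⁻¹).add (Ib.const_mul (b - l)⁻¹)).mono'
    (Continuous.aestronglyMeasurable (by fun_prop)) (Eventually.of_forall fun u => ?_)
  have key : ∀ d x y : ℝ, 0 < d → x * Real.exp y ≤ d⁻¹ * Real.exp (y + d * x) := by
    intro d x y hd
    rw [Real.exp_add, le_inv_mul_iff₀ hd]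
    have := Real.add_one_le_exp (d * x)
    nlinarith [Real.exp_pos y]
  rw [Real.norm_of_nonneg (by positivity)]
  simp only [Pi.add_apply]
  have pa : 0 ≤ (l - a)⁻¹ * Real.exp (-V u + a * u) :=
    mul_nonneg (inv_nonneg.2 (by linarith)) (Real.exp_pos _).le
  have pb : 0 ≤ (b - l)⁻¹ * Real.exp (-V u + b * u) :=
    mul_nonneg (inv_nonneg.2 (by linarith)) (Real.exp_pos _).le
  rcases abs_cases u with ⟨h, _⟩ | ⟨h, _⟩
  · rw [h]
    have := key (b - l) u (-V u + l * u) (by linarith)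
    rw [show -V u + l * u + (b - l) * u = -V u + b * u by ring] at this
    linarith
  · rw [h]
    have := key (l - a) (-u) (-V u + l * u) (by linarith)
    rw [show -V u + l * u + (l - a) * (-u) = -V u + a * u by ring] at this
    linarith

lemma tmb_integrable_id (V : ℝ → ℝ) (hc : Continuous V) (vm vp : EReal)
    (hm : Tendsto (fun x : ℝ => ((V x / x : ℝ) : EReal)) atBot (nhds vm))
    (hp : Tendsto (fun x : ℝ => ((V x / x : ℝ) : EReal)) atTop (nhds vp))
    (l : ℝ) (h1 : vm < (l : EReal)) (h2 : (l : EReal) < vp) :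
    Integrable (fun u : ℝ => u * Real.exp (-(V u) + l * u)) := by
  refine (tmb_integrable_abs V hc vm vp hm hp l h1 h2).mono'
    (Continuous.aestronglyMeasurable (by fun_prop)) (Eventually.of_forall fun u => ?_)
  rw [norm_mul, Real.norm_eq_abs, Real.norm_of_nonneg (Real.exp_pos _).le]

lemma tmb_exp_eq (V : ℝ → ℝ) (m l : ℝ) (u : ℝ) : (u - m) * Real.exp (-(V u) + l * (u - m))
    = Real.exp (-(l * m)) * (u * Real.exp (-(V u) + l * u) - m * Real.exp (-(V u) + l * u)) := by
  rw [show -(V u) + l * (u - m) = -(l * m) + (-(V u) + l * u) by ring, Real.exp_add]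
  ring

lemma tmb_integrable_F (V : ℝ → ℝ) (hc : Continuous V) (vm vp : EReal)
    (hm : Tendsto (fun x : ℝ => ((V x / x : ℝ) : EReal)) atBot (nhds vm))
    (hp : Tendsto (fun x : ℝ => ((V x / x : ℝ) : EReal)) atTop (nhds vp)) (m : ℝ)
    (l : ℝ) (h1 : vm < (l : EReal)) (h2 : (l : EReal) < vp) :
    Integrable (fun u : ℝ => (u - m) * Real.exp (-(V u) + l * (u - m))) := by
  simp only [tmb_exp_eq]
  exact ((tmb_integrable_id V hc vm vp hm hp l h1 h2).sub
    ((tmb_integrable_exp V hc vm vp hm hp l h1 h2).const_mul m)).const_mul _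

lemma tmb_F_eq (V : ℝ → ℝ) (hc : Continuous V) (vm vp : EReal)
    (hm : Tendsto (fun x : ℝ => ((V x / x : ℝ) : EReal)) atBot (nhds vm))
    (hp : Tendsto (fun x : ℝ => ((V x / x : ℝ) : EReal)) atTop (nhds vp)) (m : ℝ)
    (l : ℝ) (h1 : vm < (l : EReal)) (h2 : (l : EReal) < vp) :
    ∫ u : ℝ, (u - m) * Real.exp (-(V u) + l * (u - m)) = Real.exp (-(l * m)) *
      ((∫ u : ℝ, u * Real.exp (-(V u) + l * u)) - m * ∫ u : ℝ, Real.exp (-(V u) + l * u)) := by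
  simp only [tmb_exp_eq]
  rw [integral_const_mul, integral_sub (tmb_integrable_id V hc vm vp hm hp l h1 h2)
    ((tmb_integrable_exp V hc vm vp hm hp l h1 h2).const_mul m), integral_const_mul]

lemma tmb_Z_pos (V : ℝ → ℝ) (hc : Continuous V) (vm vp : EReal)
    (hm : Tendsto (fun x : ℝ => ((V x / x : ℝ) : EReal)) atBot (nhds vm))
    (hp : Tendsto (fun x : ℝ => ((V x / x : ℝ) : EReal)) atTop (nhds vp))
    (l : ℝ) (h1 : vm < (l : EReal)) (h2 : (l : EReal) < vp) :
    0 < ∫ u : ℝ, Real.exp (-(V u) + l * u) :=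
  integral_exp_pos (tmb_integrable_exp V hc vm vp hm hp l h1 h2)

lemma tmb_pt_mono (v x a b : ℝ) (hab : a ≤ b) :
    x * Real.exp (v + a * x) ≤ x * Real.exp (v + b * x) := by
  rcases le_total 0 x with h | h
  · exact mul_le_mul_of_nonneg_left (Real.exp_le_exp.2 (by nlinarith)) h
  · exact mul_le_mul_of_nonpos_left (Real.exp_le_exp.2 (by nlinarith)) h

lemma tmb_F_strict (V : ℝ → ℝ) (hc : Continuous V) (vm vp : EReal)
    (hm : Tendsto (fun x : ℝ => ((V x / x : ℝ) : EReal)) atBot (nhds vm))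
    (hp : Tendsto (fun x : ℝ => ((V x / x : ℝ) : EReal)) atTop (nhds vp)) (m : ℝ)
    (a b : ℝ) (h1 : vm < (a : EReal)) (hab : a < b) (h2 : (b : EReal) < vp) :
    ∫ u : ℝ, (u - m) * Real.exp (-(V u) + a * (u - m)) <
      ∫ u : ℝ, (u - m) * Real.exp (-(V u) + b * (u - m)) := by
  have hab' : (a : EReal) < b := by exact_mod_cast hab
  have Ia := tmb_integrable_F V hc vm vp hm hp m a h1 (hab'.trans h2)
  have Ib := tmb_integrable_F V hc vm vp hm hp m b (h1.trans hab') h2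
  rw [← sub_pos, ← integral_sub Ib Ia]
  rw [integral_pos_iff_support_of_nonneg
    (fun u => sub_nonneg.2 (tmb_pt_mono _ _ _ _ hab.le)) (Ib.sub Ia)]
  refine lt_of_lt_of_le (isOpen_Ioi.measure_pos volume (Set.nonempty_Ioi (a := m)))
    (measure_mono fun u hu => ?_)
  have hu' : 0 < u - m := sub_pos.2 hu
  rw [Function.mem_support]
  refine (sub_pos.2 (mul_lt_mul_of_pos_left (Real.exp_lt_exp.2 ?_) hu')).ne'
  nlinarith

lemma tmb_F_cont (V : ℝ → ℝ) (hc : Continuous V) (vm vp : EReal)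
    (hm : Tendsto (fun x : ℝ => ((V x / x : ℝ) : EReal)) atBot (nhds vm))
    (hp : Tendsto (fun x : ℝ => ((V x / x : ℝ) : EReal)) atTop (nhds vp)) (m : ℝ)
    (l : ℝ) (h1 : vm < (l : EReal)) (h2 : (l : EReal) < vp) :
    ContinuousAt (fun l : ℝ => ∫ u : ℝ, (u - m) * Real.exp (-(V u) + l * (u - m))) l := by
  obtain ⟨a, ha1, ha2⟩ := EReal.lt_iff_exists_real_btwn.1 h1
  obtain ⟨b, hb1, hb2⟩ := EReal.lt_iff_exists_real_btwn.1 h2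
  have ha2' : a < l := by exact_mod_cast ha2
  have hb1' : l < b := by exact_mod_cast hb1
  have Ia := tmb_integrable_F V hc vm vp hm hp m a ha1 (ha2.trans h2)
  have Ib := tmb_integrable_F V hc vm vp hm hp m b (h1.trans hb1) hb2
  refine continuousAt_of_dominated (Eventually.of_forall fun x =>
    Continuous.aestronglyMeasurable (by fun_prop)) ?_ (Ia.norm.add Ib.norm)
    (Eventually.of_forall fun u => Continuous.continuousAt (by fun_prop))
  filter_upwards [Ioo_mem_nhds ha2' hb1'] with x hx
  refine Eventually.of_forall fun u => ?_
  have e1 := tmb_pt_mono (-(V u)) (u - m) a x hx.1.le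
  have e2 := tmb_pt_mono (-(V u)) (u - m) x b hx.2.le
  simp only [Pi.add_apply, Real.norm_eq_abs]
  rw [abs_le]
  constructor
  · linarith [neg_abs_le ((u - m) * Real.exp (-(V u) + a * (u - m))),
      abs_nonneg ((u - m) * Real.exp (-(V u) + b * (u - m)))]
  · linarith [le_abs_self ((u - m) * Real.exp (-(V u) + b * (u - m))),
      abs_nonneg ((u - m) * Real.exp (-(V u) + a * (u - m)))]

lemma tmb_slope_le (V : ℝ → ℝ) (hV : ConvexOn ℝ Set.univ V) (vp : EReal)
    (hp : Tendsto (fun x : ℝ => ((V x / x : ℝ) : EReal)) atTop (nhds vp)) (m T : ℝ)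
    (hmT : m < T) : (((V T - V m) / (T - m) : ℝ) : EReal) ≤ vp := by
  by_contra! hlt
  obtain ⟨c, hc1, hc2⟩ := EReal.lt_iff_exists_real_btwn.1 hlt
  set s := (V T - V m) / (T - m) with hs
  have hcs : c < s := by exact_mod_cast hc2
  have h3 : ∀ᶠ x : ℝ in atTop, s * m - V m < (s - c) * x :=
    (tendsto_id.const_mul_atTop (sub_pos.2 hcs)).eventually_gt_atTop _
  obtain ⟨x, hx1, hx2, hx3, hx4⟩ := ((hp.eventually_lt_const hc1).and
    ((eventually_gt_atTop 0).and ((eventually_gt_atTop T).and h3))).exists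
  have hx' : V x / x < c := by exact_mod_cast hx1
  rw [div_lt_iff₀ hx2] at hx'
  have h := hV.secant_mono (Set.mem_univ m) (Set.mem_univ T) (Set.mem_univ x) hmT.ne'
    (by linarith) hx3.le
  rw [← hs, le_div_iff₀ (by linarith)] at h
  nlinarith

lemma tmb_F_pos (V : ℝ → ℝ) (hV : ConvexOn ℝ Set.univ V) (hc : Continuous V) (vm vp : EReal)
    (hm : Tendsto (fun x : ℝ => ((V x / x : ℝ) : EReal)) atBot (nhds vm))
    (hp : Tendsto (fun x : ℝ => ((V x / x : ℝ) : EReal)) atTop (nhds vp)) (hlt : vm < vp) (m : ℝ) :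
    ∃ l : ℝ, vm < (l : EReal) ∧ (l : EReal) < vp ∧
      0 < ∫ u : ℝ, (u - m) * Real.exp (-(V u) + l * (u - m)) := by
  obtain ⟨l0, hl1, hl2⟩ := EReal.lt_iff_exists_real_btwn.1 hlt
  have I0 := tmb_integrable_F V hc vm vp hm hp m l0 hl1 hl2
  set N := ∫ u : ℝ, |(u - m) * Real.exp (-(V u) + l0 * (u - m))| with hN
  have hN0 : 0 ≤ N := integral_nonneg fun u => abs_nonneg _
  set c := Real.exp (-(V m) - 1) with hcdef
  have hc0 : 0 < c := Real.exp_pos _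
  set T := m + 1 + (N + 1) / c with hT
  have hq : 0 < (N + 1) / c := by positivity
  have hTm : 0 < T - m := by linarith
  set s := (V T - V m) / (T - m) with hs
  have hsl : (s : EReal) ≤ vp := tmb_slope_le V hV vp hp m T (by linarith)
  have hslt : ((s - 1 / (T - m) : ℝ) : EReal) < vp := by
    refine lt_of_lt_of_le ?_ hsl
    have : 0 < 1 / (T - m) := by positivity
    exact_mod_cast (by linarith : s - 1 / (T - m) < s)
  obtain ⟨l, hla, hlb⟩ := EReal.lt_iff_exists_real_btwn.1 (max_lt hl2 hslt)
  have hl0 : (l0 : EReal) < l := lt_of_le_of_lt (le_max_left _ _) hla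
  have hl0' : l0 < l := by exact_mod_cast hl0
  have hls : s - 1 / (T - m) < l := by
    exact_mod_cast lt_of_le_of_lt (le_max_right _ _) hla
  refine ⟨l, hl1.trans hl0, hlb, ?_⟩
  have Il := tmb_integrable_F V hc vm vp hm hp m l (hl1.trans hl0) hlb
  have Iind : Integrable ((Set.Ioc (m + 1) T).indicator fun _ : ℝ => c) :=
    (integrableOn_const (by simp)).integrable_indicator measurableSet_Ioc
  have hle : ∫ u : ℝ, ((Set.Ioc (m + 1) T).indicator (fun _ : ℝ => c) u
      - |(u - m) * Real.exp (-(V u) + l0 * (u - m))|)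
      ≤ ∫ u : ℝ, (u - m) * Real.exp (-(V u) + l * (u - m)) := by
    refine integral_mono (Iind.sub I0.abs) Il fun u => ?_
    by_cases hu : u ∈ Set.Ioc (m + 1) T
    · simp only [Set.indicator_of_mem hu]
      have hum : 1 < u - m := by linarith [hu.1]
      have h := hV.secant_mono (Set.mem_univ m) (Set.mem_univ u) (Set.mem_univ T)
        (by linarith) (by linarith) hu.2
      rw [← hs, div_le_iff₀ (by linarith)] at h
      have h1 : (s - l) * (u - m) ≤ 1 := by
        have h2 : (s - l) * (u - m) ≤ 1 / (T - m) * (u - m) :=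
          mul_le_mul_of_nonneg_right (by linarith) (by linarith)
        have h3 : 1 / (T - m) * (u - m) ≤ 1 / (T - m) * (T - m) :=
          mul_le_mul_of_nonneg_left (by linarith [hu.2]) (by positivity)
        rw [one_div_mul_cancel hTm.ne'] at h3
        linarith
      have h4 : c ≤ Real.exp (-(V u) + l * (u - m)) := Real.exp_le_exp.2 (by linarith)
      have := abs_nonneg ((u - m) * Real.exp (-(V u) + l0 * (u - m)))
      nlinarith
    · simp only [Set.indicator_of_notMem hu]
      have e1 := tmb_pt_mono (-(V u)) (u - m) l0 l hl0'.le
      linarith [neg_abs_le ((u - m) * Real.exp (-(V u) + l0 * (u - m)))]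
  refine lt_of_lt_of_le ?_ hle
  rw [integral_sub Iind I0.abs, integral_indicator_const _ measurableSet_Ioc, ← hN,
    Measure.real, Real.volume_Ioc, ENNReal.toReal_ofReal (by linarith), smul_eq_mul]
  have : (T - (m + 1)) * c = N + 1 := by
    rw [hT]; field_simp; ring
  linarith

lemma tmb_F_neg (V : ℝ → ℝ) (hV : ConvexOn ℝ Set.univ V) (hc : Continuous V) (vm vp : EReal)
    (hm : Tendsto (fun x : ℝ => ((V x / x : ℝ) : EReal)) atBot (nhds vm))
    (hp : Tendsto (fun x : ℝ => ((V x / x : ℝ) : EReal)) atTop (nhds vp)) (hlt : vm < vp) (m : ℝ) :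
    ∃ l : ℝ, vm < (l : EReal) ∧ (l : EReal) < vp ∧
      ∫ u : ℝ, (u - m) * Real.exp (-(V u) + l * (u - m)) < 0 := by
  have hW : ConvexOn ℝ Set.univ (fun x => V (-x)) := by
    have := hV.comp_linearMap (-LinearMap.id)
    simpa [Function.comp_def] using this
  have heq : (fun x : ℝ => ((V (-x) / x : ℝ) : EReal))
      = fun x : ℝ => -((V (-x) / (-x) : ℝ) : EReal) := by
    funext x
    rw [← EReal.coe_neg, div_neg, neg_neg]
  have hm' : Tendsto (fun x : ℝ => ((V (-x) / x : ℝ) : EReal)) atBot (nhds (-vp)) := by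
    rw [heq]
    exact ((continuous_neg (G := EReal)).tendsto vp).comp (hp.comp tendsto_neg_atBot_atTop)
  have hp' : Tendsto (fun x : ℝ => ((V (-x) / x : ℝ) : EReal)) atTop (nhds (-vm)) := by
    rw [heq]
    exact ((continuous_neg (G := EReal)).tendsto vm).comp (hm.comp tendsto_neg_atTop_atBot)
  obtain ⟨l, h1, h2, h3⟩ := tmb_F_pos (fun x => V (-x)) hW (by fun_prop) (-vp) (-vm) hm' hp'
    (EReal.neg_lt_neg_iff.2 hlt) (-m)
  refine ⟨-l, ?_, ?_, ?_⟩
  · rw [EReal.coe_neg]; exact EReal.lt_neg_comm.1 h2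
  · rw [EReal.coe_neg]; exact EReal.neg_lt_comm.1 h1
  · rw [← integral_neg_eq_self] at h3
    rw [← neg_pos, ← integral_neg]
    convert h3 using 3 with u
    simp only [neg_neg]
    rw [show -l * (u - m) = l * (-u - -m) by ring]
    ring

/-- **The tilted mean function.** For `V ∈ 𝒞` with asymptotic slopes `vm < vp` (in the extended
reals), and `I = (vm, vp)`: for every `λ ∈ I` the integrals `∫ e^{-V(u)+λu} du` and
`∫ |u| e^{-V(u)+λu} du` are finite, and the function
`ψ(λ) = (∫ u e^{-V(u)+λu} du)/(∫ e^{-V(u)+λu} du)` is strictly increasing on `I` and maps `I`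
bijectively onto `ℝ`. -/
theorem tilted_mean_bijective (V : ℝ → ℝ) (hV : InClassC V) (vm vp : EReal)
    (hm : Tendsto (fun x : ℝ => ((V x / x : ℝ) : EReal)) atBot (nhds vm))
    (hp : Tendsto (fun x : ℝ => ((V x / x : ℝ) : EReal)) atTop (nhds vp)) :
    (∀ l : ℝ, vm < (l : EReal) → (l : EReal) < vp →
      (MeasureTheory.Integrable (fun u : ℝ => Real.exp (-(V u) + l * u)) ∧
       MeasureTheory.Integrable (fun u : ℝ => |u| * Real.exp (-(V u) + l * u)))) ∧
    StrictMonoOn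
      (fun l : ℝ => (∫ u : ℝ, u * Real.exp (-(V u) + l * u)) /
        ∫ u : ℝ, Real.exp (-(V u) + l * u))
      { l : ℝ | vm < (l : EReal) ∧ (l : EReal) < vp } ∧
    (fun l : ℝ => (∫ u : ℝ, u * Real.exp (-(V u) + l * u)) /
        ∫ u : ℝ, Real.exp (-(V u) + l * u)) ''
      { l : ℝ | vm < (l : EReal) ∧ (l : EReal) < vp } = Set.univ := by
  have hc : Continuous V := continuousOn_univ.1 (hV.convex.continuousOn isOpen_univ)
  have hlt : vm < vp := by
    obtain ⟨a, b, ha, hb, hab⟩ := hV.slopes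
    rwa [tendsto_nhds_unique hm ha, tendsto_nhds_unique hp hb]
  refine ⟨fun l h1 h2 => ⟨tmb_integrable_exp V hc vm vp hm hp l h1 h2,
    tmb_integrable_abs V hc vm vp hm hp l h1 h2⟩, ?_, ?_⟩
  · rintro a ⟨ha1, ha2⟩ b ⟨hb1, hb2⟩ hab
    simp only
    have Za := tmb_Z_pos V hc vm vp hm hp a ha1 ha2
    have Zb := tmb_Z_pos V hc vm vp hm hp b hb1 hb2
    set m := (∫ u : ℝ, u * Real.exp (-(V u) + a * u)) / ∫ u : ℝ, Real.exp (-(V u) + a * u)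
      with hmdef
    have h := tmb_F_strict V hc vm vp hm hp m a b ha1 hab hb2
    rw [tmb_F_eq V hc vm vp hm hp m a ha1 ha2, tmb_F_eq V hc vm vp hm hp m b hb1 hb2,
      hmdef, div_mul_cancel₀ _ Za.ne', sub_self, mul_zero, ← hmdef] at h
    rw [lt_div_iff₀ Zb]
    linarith [pos_of_mul_pos_right h (Real.exp_pos _).le]
  · refine Set.eq_univ_of_forall fun m => ?_
    obtain ⟨p, hp1, hp2, hp3⟩ := tmb_F_pos V hV.convex hc vm vp hm hp hlt m
    obtain ⟨n, hn1, hn2, hn3⟩ := tmb_F_neg V hV.convex hc vm vp hm hp hlt m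
    have hconn : Set.OrdConnected { l : ℝ | vm < (l : EReal) ∧ (l : EReal) < vp } := by
      refine ⟨fun x hx y hy z hz => ⟨lt_of_lt_of_le hx.1 ?_, lt_of_le_of_lt ?_ hy.2⟩⟩
      · exact_mod_cast hz.1
      · exact_mod_cast hz.2
    obtain ⟨l, hl, hl0⟩ := hconn.isPreconnected.intermediate_value
      (f := fun l : ℝ => ∫ u : ℝ, (u - m) * Real.exp (-(V u) + l * (u - m)))
      (a := n) (b := p) ⟨hn1, hn2⟩ ⟨hp1, hp2⟩
      (fun l hl => (tmb_F_cont V hc vm vp hm hp m l hl.1 hl.2).continuousWithinAt)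
      ⟨hn3.le, hp3.le⟩
    refine ⟨l, hl, ?_⟩
    have Z := tmb_Z_pos V hc vm vp hm hp l hl.1 hl.2
    simp only at hl0 ⊢
    rw [tmb_F_eq V hc vm vp hm hp m l hl.1 hl.2] at hl0
    rw [div_eq_iff Z.ne']
    rcases mul_eq_zero.1 hl0 with h | h
    · exact absurd h (Real.exp_pos _).ne'
    · linarith

end
end

section
/- (Comparison with a product measure.) Let V be in the class 𝒞, let λ ∈ (V'_-, V'_+) be the unique value with ∫ u·e^{−V(u)+λu} du = 0 (which exists and is unique), and set Ṽ(u) = V(u) − λu. Let ν_N be the probability measure on ℝ^N under which η_1,…,η_N are i.i.d. with density proportional to e^{−Ṽ}. Fix a ∈ (0,1) and write N_a = ⌊aN⌋. Then there exists a constant C_a > 0 such that for all N ≥ 1 and all bounded measurable f : ℝ^{N_a} → [0,∞), E_{π_N}[f(η_1,…,η_{N_a})] ≤ C_a · E_{ν_N}[f(η_1,…,η_{N_a})], where under π_N one sets η_k = x_k − x_{k−1}. -/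
open MeasureTheory Filter Real

noncomputable section

/-- Configuration in `Ω_N` built from the `N-1` inner coordinates: coordinates
`1,…,N-1` are free, all others (in particular `0` and `N`) vanish. -/
def conf (N : ℕ) (y : Fin (N - 1) → ℝ) : ℕ → ℝ := fun k =>
  if h : 1 ≤ k ∧ k ≤ N - 1 then y ⟨k - 1, by omega⟩ else 0

/-- The Hamiltonian `H(x) = Σ_{k=1}^N V(x_k - x_{k-1})`. -/
def Ham (V : ℝ → ℝ) (N : ℕ) (x : ℕ → ℝ) : ℝ :=
  ∑ k ∈ Finset.range N, V (x (k + 1) - x k)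

/-- Normalisation constant `Z_N`. -/
def Zpart (V : ℝ → ℝ) (N : ℕ) : ℝ :=
  ∫ y : Fin (N - 1) → ℝ, Real.exp (-(Ham V N (conf N y)))

/-- The Gibbs measure `π_N` on `Ω_N`, viewed as a measure on configurations `ℕ → ℝ`:
the inner coordinates have density `e^{-H}/Z_N` w.r.t. Lebesgue measure. -/
def piN (V : ℝ → ℝ) (N : ℕ) : Measure (ℕ → ℝ) :=
  Measure.map (conf N)
    (volume.withDensity fun y : Fin (N - 1) → ℝ =>
      ENNReal.ofReal (Real.exp (-(Ham V N (conf N y))) / Zpart V N))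

/-- The increments `η_k = x_k - x_{k-1}`, `k = 1,…,N`. -/
def incr (N : ℕ) (x : ℕ → ℝ) : Fin N → ℝ := fun k => x ((k : ℕ) + 1) - x (k : ℕ)

/-- The product measure `ν_N` under which `η_1,…,η_N` are i.i.d. with density proportional to
`e^{-Ṽ}`, `Ṽ(u) = V(u) - λu`. -/
def nuN (V : ℝ → ℝ) (lam : ℝ) (N : ℕ) : Measure (Fin N → ℝ) :=
  Measure.pi fun _ => volume.withDensity fun u : ℝ =>
    ENNReal.ofReal (Real.exp (-(V u - lam * u)) /
      ∫ s : ℝ, Real.exp (-(V s - lam * s)))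

/-- `l` lies in the open interval `I = (V'_-, V'_+)` of asymptotic slopes of `V`. -/
def InSlopeInterval (V : ℝ → ℝ) (l : ℝ) : Prop :=
  ∃ vm vp : EReal,
    Tendsto (fun x : ℝ => ((V x / x : ℝ) : EReal)) atBot (nhds vm) ∧
    Tendsto (fun x : ℝ => ((V x / x : ℝ) : EReal)) atTop (nhds vp) ∧
    vm < (l : EReal) ∧ (l : EReal) < vp


structure GoodDens (p : ℝ → ℝ) : Prop where
  cont : Continuous p
  pos : ∀ u, 0 < p u
  integrable : Integrable p
  mass : ∫ u, p u = 1
  integrable_sq : Integrable (fun u => u ^ 2 * p u)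
  mean : ∫ u, u * p u = 0
  unimodal : ∃ m, MonotoneOn p (Set.Iic m) ∧ AntitoneOn p (Set.Ici m)

def densMeas (p : ℝ → ℝ) : Measure ℝ := volume.withDensity fun u => ENNReal.ofReal (p u)

/-- iterated convolutions -/
def cv (p : ℝ → ℝ) : ℕ → ℝ → ℝ
  | 0 => p
  | k + 1 => fun s => ∫ u, cv p k (s - u) * p u

namespace GoodDens
variable {p : ℝ → ℝ}

lemma bdd (hp : GoodDens p) : ∃ A, 0 < A ∧ ∀ u, p u ≤ A := by
  obtain ⟨m, h1, h2⟩ := hp.unimodal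
  refine ⟨p m, hp.pos m, fun u => ?_⟩
  rcases le_total u m with h | h
  · exact h1 h (Set.mem_Iic.2 le_rfl) h
  · exact h2 (Set.mem_Ici.2 le_rfl) h h

lemma isProb (hp : GoodDens p) : IsProbabilityMeasure (densMeas p) := by
  constructor
  rw [densMeas, withDensity_apply _ MeasurableSet.univ, Measure.restrict_univ,
    ← ofReal_integral_eq_lintegral_ofReal hp.integrable (ae_of_all _ fun u => (hp.pos u).le), hp.mass]
  simp

lemma integral_densMeas (hp : GoodDens p) {E : Type*} [NormedAddCommGroup E] [NormedSpace ℝ E] (f : ℝ → E) :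
    ∫ u, f u ∂(densMeas p) = ∫ u, p u • f u := by
  rw [densMeas, integral_withDensity_eq_integral_toReal_smul]
  · simp only [ENNReal.toReal_ofReal (hp.pos _).le]
  · exact hp.cont.measurable.ennreal_ofReal
  · exact ae_of_all _ fun _ => ENNReal.ofReal_lt_top

lemma cv_props (hp : GoodDens p) {A : ℝ} (hA : ∀ u, p u ≤ A) (k : ℕ) :
    Continuous (cv p k) ∧ (∀ s, 0 < cv p k s) ∧ (∀ s, cv p k s ≤ A) := by
  induction k with
  | zero => exact ⟨hp.cont, hp.pos, hA⟩
  | succ k ih =>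
    obtain ⟨h1, h2, h3⟩ := ih
    have hintg : ∀ s, Integrable (fun u => cv p k (s - u) * p u) := fun s => by
      refine (hp.integrable.const_mul A).mono' ?_ ?_
      · exact ((h1.comp (continuous_const.sub continuous_id)).mul hp.cont).aestronglyMeasurable
      · refine ae_of_all _ fun u => ?_
        rw [Real.norm_of_nonneg (mul_nonneg (h2 _).le (hp.pos u).le)]
        exact mul_le_mul_of_nonneg_right (h3 _) (hp.pos u).le
    refine ⟨?_, fun s => ?_, fun s => ?_⟩
    · refine continuous_of_dominated (bound := fun u => A * p u) ?_ ?_ (hp.integrable.const_mul A) ?_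
      · intro s
        exact ((h1.comp (continuous_const.sub continuous_id)).mul hp.cont).aestronglyMeasurable
      · intro s
        refine ae_of_all _ fun u => ?_
        rw [Real.norm_of_nonneg (mul_nonneg (h2 _).le (hp.pos u).le)]
        exact mul_le_mul_of_nonneg_right (h3 _) (hp.pos u).le
      · exact ae_of_all _ fun u => (h1.comp (continuous_id.sub continuous_const)).mul continuous_const
    · show 0 < ∫ u, cv p k (s - u) * p u
      rw [integral_pos_iff_support_of_nonneg (fun u => (mul_pos (h2 _) (hp.pos u)).le) (hintg s)]
      have : Function.support (fun u => cv p k (s - u) * p u) = Set.univ := by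
        ext u; simp [(h2 (s-u)).ne', (hp.pos u).ne']
      rw [this]; simp
    · calc cv p (k+1) s = ∫ u, cv p k (s - u) * p u := rfl
        _ ≤ ∫ u, A * p u := integral_mono (hintg s) (hp.integrable.const_mul A)
            fun u => mul_le_mul_of_nonneg_right (h3 _) (hp.pos u).le
        _ = A := by rw [integral_const_mul, hp.mass, mul_one]

/-- translation estimate -/
lemma translate_bound (hp : GoodDens p) {A : ℝ} (hA : ∀ u, p u ≤ A) {h : ℝ} (hh : 0 ≤ h) :
    ∫ u, |p u - p (u + h)| ≤ 3 * A * h := by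
  obtain ⟨m, h1, h2⟩ := hp.unimodal
  have hi : Integrable (fun u => p (u + h)) := hp.integrable.comp_add_right h
  have hI : Integrable (fun u => |p u - p (u + h)|) := (hp.integrable.sub hi).abs
  have hii : ∀ a b, IntervalIntegrable p volume a b := fun a b => hp.cont.intervalIntegrable a b
  have t1 : ∫ u in Set.Ioi m, p (u + h) = ∫ u in Set.Ioi (m + h), p u := by
    have := (measurePreserving_add_right volume h).setIntegral_preimage_emb
      (measurableEmbedding_addRight h) p (Set.Ioi (m + h))
    rwa [Set.preimage_add_const_Ioi, add_sub_cancel_right] at this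
  have t2 : ∫ u in Set.Iic (m - h), p (u + h) = ∫ u in Set.Iic m, p u := by
    have := (measurePreserving_add_right volume h).setIntegral_preimage_emb
      (measurableEmbedding_addRight h) p (Set.Iic m)
    rwa [Set.preimage_add_const_Iic] at this
  have e1 : ∫ u in Set.Ioi m, |p u - p (u + h)| = ∫ u in m..(m+h), p u := by
    have : ∫ u in Set.Ioi m, |p u - p (u + h)| = ∫ u in Set.Ioi m, (p u - p (u + h)) := by
      refine setIntegral_congr_fun measurableSet_Ioi fun u hu => ?_
      have hu : m < u := hu
      exact abs_of_nonneg (sub_nonneg.2 (h2 (Set.mem_Ici.2 hu.le)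
        (Set.mem_Ici.2 (by linarith)) (by linarith)))
    rw [this, integral_sub hp.integrable.integrableOn hi.integrableOn,
      t1,
      intervalIntegral.integral_Ioi_sub_Ioi' hp.integrable.integrableOn hp.integrable.integrableOn]
  have e2 : ∫ u in Set.Iic (m - h), |p u - p (u + h)| = ∫ u in (m-h)..m, p u := by
    have : ∫ u in Set.Iic (m-h), |p u - p (u + h)| = ∫ u in Set.Iic (m-h), (p (u+h) - p u) := by
      refine setIntegral_congr_fun measurableSet_Iic fun u hu => ?_
      have hu : u ≤ m - h := hu
      show |p u - p (u + h)| = _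
      rw [abs_sub_comm]
      exact abs_of_nonneg (sub_nonneg.2 (h1 (Set.mem_Iic.2 (by linarith))
        (Set.mem_Iic.2 (by linarith)) (by linarith)))
    rw [this, integral_sub hi.integrableOn hp.integrable.integrableOn,
      t2,
      intervalIntegral.integral_Iic_sub_Iic hp.integrable.integrableOn hp.integrable.integrableOn]
  have e3 : ∫ u, |p u - p (u + h)| = (∫ u in Set.Iic (m - h), |p u - p (u + h)|) +
      (∫ u in (m-h)..m, |p u - p (u + h)|) + ∫ u in Set.Ioi m, |p u - p (u + h)| := by
    rw [← intervalIntegral.integral_Iic_sub_Iic hI.integrableOn hI.integrableOn,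
      ← intervalIntegral.integral_Iic_add_Ioi (b := m) hI.integrableOn hI.integrableOn]
    ring
  have b1 : ∀ a, ∫ u in a..(a+h), p u ≤ A * h := fun a => by
    calc ∫ u in a..(a+h), p u ≤ ∫ u in a..(a+h), A :=
          intervalIntegral.integral_mono_on (by linarith) (hii _ _) (by simp) fun u _ => hA u
      _ = A * h := by simp [mul_comm]
  have b2 : ∫ u in (m-h)..m, |p u - p (u + h)| ≤ A * h := by
    calc ∫ u in (m-h)..m, |p u - p (u + h)| ≤ ∫ u in (m-h)..m, A := by
          refine intervalIntegral.integral_mono_on (by linarith) ?_ (by simp) fun u _ => ?_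
          · exact hI.intervalIntegrable
          · have := hA u; have := hA (u+h); have := hp.pos u; have := hp.pos (u+h)
            rw [abs_le]; constructor <;> linarith
      _ = A * h := by simp [mul_comm]
  have := b1 m
  have h4 := b1 (m-h)
  rw [sub_add_cancel] at h4
  rw [e3, e1, e2]; linarith

end GoodDens


open FourierTransform in
def psi (p : ℝ → ℝ) (w : ℝ) : ℂ := 𝓕 (fun u => (p u : ℂ)) w

namespace GoodDens
variable {p : ℝ → ℝ}

lemma psi_eq_charFun (hp : GoodDens p) (w : ℝ) : psi p w = charFun (densMeas p) (-(2 * π * w)) := by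
  rw [psi, Real.fourier_real_eq_integral_exp_smul, charFun_apply_real, hp.integral_densMeas]
  refine integral_congr_ae (ae_of_all _ fun u => ?_)
  simp only [smul_eq_mul, Complex.real_smul]
  rw [mul_comm]
  congr 2
  push_cast
  ring

lemma psi_cont (hp : GoodDens p) : Continuous (psi p) := by
  have := hp.isProb
  have h : psi p = fun w => charFun (densMeas p) (-(2 * π * w)) := funext hp.psi_eq_charFun
  rw [h]
  exact (continuous_charFun).comp (by fun_prop)

lemma psi_le_one (hp : GoodDens p) (w : ℝ) : ‖psi p w‖ ≤ 1 := by
  have := hp.isProb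
  rw [hp.psi_eq_charFun]; exact norm_charFun_le_one _

lemma psi_neg_norm (hp : GoodDens p) (w : ℝ) : ‖psi p (-w)‖ = ‖psi p w‖ := by
  rw [hp.psi_eq_charFun, hp.psi_eq_charFun, mul_neg, charFun_neg, RCLike.norm_conj]

lemma psi_decay (hp : GoodDens p) : ∃ C, 0 < C ∧ ∀ w, w ≠ 0 → ‖psi p w‖ ≤ C / |w| := by
  obtain ⟨A, hA0, hA⟩ := hp.bdd
  refine ⟨A, hA0, ?_⟩
  have key : ∀ w, 0 < w → ‖psi p w‖ ≤ A / w := by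
    intro w hw
    have h1 := fourierIntegral_eq_half_sub_half_period_translate (f := fun u : ℝ => (p u : ℂ)) hw.ne'
      hp.integrable.ofReal
    have h2 : psi p w = ∫ v : ℝ, fourierChar (-(inner ℝ v w)) • (p v : ℂ) := rfl
    rw [h2, h1, norm_smul]
    have h3 : (1 / (2 * ‖w‖ ^ 2)) • w = 1 / (2 * w) := by
      rw [Real.norm_of_nonneg hw.le, smul_eq_mul]; field_simp
    have h4 : ‖∫ v : ℝ, fourierChar (-(inner ℝ v w)) • ((p v : ℂ) - (p (v + (1 / (2 * ‖w‖ ^ 2)) • w) : ℂ))‖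
        ≤ 3 * A * (1 / (2 * w)) := by
      refine (norm_integral_le_integral_norm _).trans ?_
      rw [h3]
      refine le_trans (le_of_eq ?_) (hp.translate_bound hA (h := 1 / (2 * w)) (by positivity))
      refine integral_congr_ae (ae_of_all _ fun u => ?_)
      simp only [Circle.norm_smul]
      rw [← Complex.ofReal_sub, Complex.norm_real, Real.norm_eq_abs]
    have h5 : ‖(1 / 2 : ℂ)‖ = 1 / 2 := by simp
    rw [h5]
    calc _ ≤ 1 / 2 * (3 * A * (1 / (2 * w))) := by gcongr
      _ = 3 / 4 * (A / w) := by field_simp; ring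
      _ ≤ 1 * (A / w) := by gcongr; norm_num
      _ = A / w := one_mul _
  intro w hw
  rcases lt_or_gt_of_ne hw with h | h
  · rw [← hp.psi_neg_norm, abs_of_neg h]; exact key _ (by linarith)
  · rw [abs_of_pos h]; exact key _ h

lemma psi_lt_one (hp : GoodDens p) {w : ℝ} (hw : w ≠ 0) : ‖psi p w‖ < 1 := by
  have := hp.isProb
  set t := -(2 * π * w) with ht
  have ht0 : t ≠ 0 := by
    rw [ht]; simp [hw, Real.pi_ne_zero]
  rw [hp.psi_eq_charFun, ← ht, charFun_apply_real]
  have h := ae_eq_const_or_norm_integral_lt_of_norm_le_const (μ := densMeas p)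
    (f := fun x : ℝ => Complex.exp (t * x * Complex.I)) (C := 1)
    (ae_of_all _ fun x => by
      rw [← Complex.ofReal_mul, Complex.norm_exp_ofReal_mul_I])
  rcases h with h | h
  · exfalso
    set c := ⨍ x : ℝ, Complex.exp (t * x * Complex.I) ∂(densMeas p)
    have hac : (volume : Measure ℝ) ≪ densMeas p := by
      refine withDensity_absolutelyContinuous' ?_ ?_
      · exact hp.cont.measurable.ennreal_ofReal.aemeasurable
      · exact ae_of_all _ fun u => by simp [hp.pos u]
    have h' : (fun x : ℝ => Complex.exp (t * x * Complex.I)) =ᵐ[volume] fun _ => c := hac.ae_eq h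
    have h'' := (Continuous.ae_eq_iff_eq volume (by fun_prop) continuous_const).1 h'
    have a0 := congrFun h'' 0
    have a1 := congrFun h'' (π / t)
    rw [← a0] at a1
    have : ((t : ℂ) * ((π / t : ℝ) : ℂ) * Complex.I) = π * Complex.I := by
      push_cast
      have : (t : ℂ) ≠ 0 := by exact_mod_cast ht0
      field_simp
    simp only [this, Complex.exp_pi_mul_I] at a1
    norm_num at a1
  · simpa using h

lemma integral_sq_pos (hp : GoodDens p) : 0 < ∫ u, u ^ 2 * p u := by
  rw [integral_pos_iff_support_of_nonneg (fun u => mul_nonneg (sq_nonneg u) (hp.pos u).le) hp.integrable_sq]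
  have : Set.Ioi (0 : ℝ) ⊆ Function.support (fun u => u ^ 2 * p u) := by
    intro u hu
    have hu : 0 < u := hu
    have := hp.pos u
    simp only [Function.mem_support]; positivity
  refine lt_of_lt_of_le ?_ (measure_mono this)
  simp

/-- normalised -/
lemma norm_facts (hp : GoodDens p) : ∃ σ : ℝ, 0 < σ ∧ (∫ u, (fun u : ℝ => σ⁻¹ * u) u ∂(densMeas p)) = 0 ∧
    (∫ u, ((fun u : ℝ => σ⁻¹ * u) ^ 2) u ∂(densMeas p)) = 1 ∧
    ∀ w, psi p w = charFun ((densMeas p).map (fun u : ℝ => σ⁻¹ * u)) (-(2 * π * w) * σ) := by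
  have h0 := hp.integral_sq_pos
  have hs : 0 < √(∫ u, u ^ 2 * p u) := Real.sqrt_pos.2 h0
  refine ⟨√(∫ u, u ^ 2 * p u), hs, ?_, ?_, ?_⟩
  · rw [integral_const_mul, hp.integral_densMeas]
    simp only [smul_eq_mul, mul_comm (p _), hp.mean, mul_zero]
  · simp only [Pi.pow_apply, mul_pow]
    rw [integral_const_mul, hp.integral_densMeas]
    simp only [smul_eq_mul, mul_comm (p _)]
    rw [inv_pow, Real.sq_sqrt h0.le, inv_mul_cancel₀ h0.ne']
  · intro w
    rw [charFun_map_mul, hp.psi_eq_charFun]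
    congr 1
    field_simp

lemma psi_near (hp : GoodDens p) : ∃ κ > 0, ∃ δ > 0, ∀ w, |w| ≤ δ → κ * w ^ 2 ≤ 1 ∧ ‖psi p w‖ ≤ 1 - κ * w ^ 2 := by
  have := hp.isProb
  obtain ⟨σ, hσ, h0, h1, h2⟩ := hp.norm_facts
  have ht := taylor_charFun_two (P := densMeas p) (X := fun u : ℝ => σ⁻¹ * u) (by fun_prop) h0 h1
  have ht' := ht.def (c := 1/4) (by norm_num)
  obtain ⟨d, hd, hd'⟩ := Metric.eventually_nhds_iff.1 ht'
  refine ⟨(2 * π * σ) ^ 2 / 4, by positivity, min d 1 / (2 * (2 * π * σ)), by positivity, fun w hw => ?_⟩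
  set t := -(2 * π * w) * σ with htt
  have hpos : 0 < 2 * π * σ := by positivity
  have ht1 : |t| ≤ min d 1 / 2 := by
    have : |t| = |w| * (2 * π * σ) := by
      rw [htt, abs_mul, abs_neg, abs_mul, abs_of_pos hσ, abs_of_pos (by positivity : 0 < 2 * π)]; ring
    rw [this]
    rw [le_div_iff₀ (by positivity)] at hw
    linarith
  have hmd : 0 < min d 1 := by positivity
  have htd : |t| < d := by have := min_le_left d 1; linarith
  have ht1' : |t| ≤ 1 := by have := min_le_right d 1; linarith
  have hsq : t ^ 2 ≤ 1 := by rw [← sq_abs]; exact pow_le_one₀ (abs_nonneg t) ht1'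
  have e : (2 * π * σ) ^ 2 / 4 * w ^ 2 = t ^ 2 / 4 := by rw [htt]; ring
  rw [e]
  refine ⟨by linarith, ?_⟩
  have h3 := hd' (y := t) (by simpa [Real.dist_eq] using htd)
  rw [← h2 w] at h3
  have h4 : ‖(1 - (t : ℂ) ^ 2 / 2)‖ = 1 - t ^ 2 / 2 := by
    have : (1 - (t : ℂ) ^ 2 / 2) = ((1 - t ^ 2 / 2 : ℝ) : ℂ) := by push_cast; ring
    rw [this, Complex.norm_real, Real.norm_of_nonneg (by linarith)]
  have h5 : ‖psi p w‖ ≤ ‖psi p w - (1 - (t : ℂ) ^ 2 / 2)‖ + ‖(1 - (t : ℂ) ^ 2 / 2)‖ := by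
    have := norm_add_le (psi p w - (1 - (t : ℂ) ^ 2 / 2)) (1 - (t : ℂ) ^ 2 / 2)
    rwa [sub_add_cancel] at this
  rw [Real.norm_of_nonneg (sq_nonneg t)] at h3
  rw [h4] at h5
  linarith

lemma psi_bound (hp : GoodDens p) : ∃ c > 0, ∀ w, ‖psi p w‖ ^ 2 ≤ 1 / (1 + c * w ^ 2) := by
  obtain ⟨κ, hκ, δ, hδ, hnear⟩ := hp.psi_near
  obtain ⟨C, hC, hfar⟩ := hp.psi_decay
  -- middle
  obtain ⟨q, hq0, hq1, hq⟩ : ∃ q, 0 ≤ q ∧ q < 1 ∧ ∀ w, δ ≤ |w| → |w| ≤ 2 * C → ‖psi p w‖ ≤ q := by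
    set K : Set ℝ := {w | δ ≤ |w|} ∩ Set.Icc (-(2 * C)) (2 * C)
    have hK : IsCompact K := isCompact_Icc.inter_left (isClosed_le continuous_const continuous_abs)
    rcases K.eq_empty_or_nonempty with h | h
    · refine ⟨0, le_rfl, one_pos, fun w h1 h2 => ?_⟩
      have : w ∈ K := ⟨h1, abs_le.1 h2⟩
      rw [h] at this; exact this.elim
    · obtain ⟨w0, hw0, hmax⟩ := hK.exists_isMaxOn h hp.psi_cont.norm.continuousOn
      refine ⟨‖psi p w0‖, norm_nonneg _, hp.psi_lt_one ?_, fun w h1 h2 => hmax ⟨h1, abs_le.1 h2⟩⟩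
      have h1 : δ ≤ |w0| := hw0.1
      intro h; rw [h, abs_zero] at h1; linarith
  have hR : 0 < (2 * C) ^ 2 := by positivity
  have hq2 : q ^ 2 < 1 := by nlinarith
  set c := min κ (min ((1 - q ^ 2) / (2 * C) ^ 2) (1 / (2 * C ^ 2))) with hc
  have hcpos : 0 < c := by
    refine lt_min hκ (lt_min (div_pos (by linarith) hR) (by positivity))
  have c1 : c ≤ κ := min_le_left _ _
  have c2 : c ≤ (1 - q ^ 2) / (2 * C) ^ 2 := (min_le_right _ _).trans (min_le_left _ _)
  have c3 : c ≤ 1 / (2 * C ^ 2) := (min_le_right _ _).trans (min_le_right _ _)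
  refine ⟨c, hcpos, fun w => ?_⟩
  rw [le_div_iff₀ (by positivity)]
  have hn := norm_nonneg (psi p w)
  rcases le_total |w| δ with h | h
  · obtain ⟨h1, h2⟩ := hnear w h
    set x := κ * w ^ 2
    have hx : 0 ≤ x := by positivity
    have h3 : ‖psi p w‖ ^ 2 ≤ 1 - x := by
      calc ‖psi p w‖ ^ 2 ≤ (1 - x) ^ 2 := by gcongr
        _ ≤ 1 - x := by nlinarith
    calc ‖psi p w‖ ^ 2 * (1 + c * w ^ 2) ≤ (1 - x) * (1 + x) := by
          have hcx : c * w ^ 2 ≤ x := mul_le_mul_of_nonneg_right c1 (sq_nonneg w)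
          gcongr
      _ ≤ 1 := by nlinarith
  · rcases le_total |w| (2 * C) with h' | h'
    · have h1 := hq w h h'
      have h2 : c * w ^ 2 ≤ 1 - q ^ 2 := by
        calc c * w ^ 2 ≤ (1 - q ^ 2) / (2 * C) ^ 2 * (2 * C) ^ 2 := by
              rw [← sq_abs w]; gcongr
          _ = 1 - q ^ 2 := by field_simp
      calc ‖psi p w‖ ^ 2 * (1 + c * w ^ 2) ≤ q ^ 2 * (1 + (1 - q ^ 2)) := by gcongr
        _ ≤ 1 := by nlinarith [sq_nonneg (q ^ 2 - 1)]
    · have hw : 0 < |w| := by linarith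
      have h1 := hfar w (abs_pos.1 hw)
      have h2 : ‖psi p w‖ ^ 2 ≤ C ^ 2 / w ^ 2 := by
        calc ‖psi p w‖ ^ 2 ≤ (C / |w|) ^ 2 := by gcongr
          _ = C ^ 2 / w ^ 2 := by rw [div_pow, sq_abs]
      have hw2 : (2 * C) ^ 2 ≤ w ^ 2 := by rw [← sq_abs w]; gcongr
      have hw20 : 0 < w ^ 2 := by linarith
      calc ‖psi p w‖ ^ 2 * (1 + c * w ^ 2) ≤ C ^ 2 / w ^ 2 * (1 + 1 / (2 * C ^ 2) * w ^ 2) := by gcongr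
        _ = C ^ 2 / w ^ 2 + 1 / 2 := by
            have : w ^ 2 ≠ 0 := hw20.ne'
            generalize w ^ 2 = y at this
            field_simp
        _ ≤ 1 / 2 + 1 / 2 := by
            have : C ^ 2 / w ^ 2 ≤ 1 / 2 := by rw [div_le_iff₀ hw20]; nlinarith
            linarith
        _ = 1 := by norm_num

end GoodDens


lemma integrable_cauchy {c : ℝ} (hc : 0 < c) : Integrable (fun w : ℝ => 1 / (1 + c * w ^ 2)) := by
  have h := (integrable_inv_one_add_sq).comp_mul_left' (R := √c) (Real.sqrt_pos.2 hc).ne'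
  refine h.congr (ae_of_all _ fun w => ?_)
  simp only [mul_pow, Real.sq_sqrt hc.le, one_div]

namespace GoodDens
variable {p : ℝ → ℝ}

lemma psi_pow_integrable (hp : GoodDens p) (k : ℕ) : Integrable (fun w => psi p w ^ (k + 2)) := by
  obtain ⟨c, hc, h⟩ := hp.psi_bound
  refine (integrable_cauchy hc).mono' (hp.psi_cont.pow _).aestronglyMeasurable (ae_of_all _ fun w => ?_)
  rw [norm_pow]
  calc ‖psi p w‖ ^ (k + 2) ≤ ‖psi p w‖ ^ 2 :=
        pow_le_pow_of_le_one (norm_nonneg _) (hp.psi_le_one w) (by omega)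
    _ ≤ _ := h w

open FourierTransform Convolution in
lemma inversion_one (hp : GoodDens p) (s : ℝ) : (cv p 1 s : ℂ) =
    ∫ w : ℝ, Complex.exp (((2 * π * (w * s) : ℝ) : ℂ) * Complex.I) * psi p w ^ 2 := by
  obtain ⟨A, hA0, hA⟩ := hp.bdd
  set P : ℝ → ℂ := fun u => (p u : ℂ)
  have hP : Integrable P := hp.integrable.ofReal
  have e : (P ⋆[ContinuousLinearMap.mul ℂ ℂ] P) = fun s => (cv p 1 s : ℂ) := by
    funext s
    rw [convolution_def]
    simp only [ContinuousLinearMap.mul_apply', P]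
    show _ = ((∫ u, p (s - u) * p u : ℝ) : ℂ)
    rw [← integral_complex_ofReal]
    refine integral_congr_ae (ae_of_all _ fun u => ?_)
    push_cast; ring
  have h1 : Integrable (P ⋆[ContinuousLinearMap.mul ℂ ℂ] P) := hP.integrable_convolution _ hP
  have h2 : 𝓕 (P ⋆[ContinuousLinearMap.mul ℂ ℂ] P) = fun w => psi p w ^ 2 := by
    funext w
    rw [Real.fourier_mul_convolution_eq hP hP, sq]; rfl
  have h3 : Continuous (P ⋆[ContinuousLinearMap.mul ℂ ℂ] P) := by
    rw [e]; exact Complex.continuous_ofReal.comp (hp.cv_props hA 1).1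
  have h4 := h3.fourierInv_fourier_eq h1 (by rw [h2]; exact hp.psi_pow_integrable 0)
  have h5 := congrFun h4 s
  rw [h2, e] at h5
  simp only at h5
  rw [← h5, Real.fourierInv_eq']
  refine integral_congr_ae (ae_of_all _ fun u => ?_)
  simp [mul_comm]

lemma inversion (hp : GoodDens p) (k : ℕ) (s : ℝ) : (cv p (k + 1) s : ℂ) =
    ∫ w : ℝ, Complex.exp (((2 * π * (w * s) : ℝ) : ℂ) * Complex.I) * psi p w ^ (k + 2) := by
  induction k generalizing s with
  | zero => exact hp.inversion_one s
  | succ k ih =>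
    have h1 : (cv p (k + 2) s : ℂ) = ∫ u, ∫ w : ℝ, Complex.exp (((2 * π * (w * (s - u)) : ℝ) : ℂ) * Complex.I)
        * psi p w ^ (k + 2) * (p u : ℂ) := by
      show ((∫ u, cv p (k + 1) (s - u) * p u : ℝ) : ℂ) = _
      rw [← integral_complex_ofReal]
      refine integral_congr_ae (ae_of_all _ fun u => ?_)
      simp only
      rw [integral_mul_const, Complex.ofReal_mul, ih]
    rw [h1, integral_integral_swap]
    · refine integral_congr_ae (ae_of_all _ fun w => ?_)
      simp only
      have hψ : psi p w = ∫ v : ℝ, Complex.exp (((-2 * π * v * w : ℝ) : ℂ) * Complex.I) • (p v : ℂ) := by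
        rw [psi, Real.fourier_real_eq_integral_exp_smul]
      rw [pow_succ _ (k + 2), ← mul_assoc]
      generalize psi p w ^ (k + 2) = Q
      rw [hψ, ← integral_const_mul]
      refine integral_congr_ae (ae_of_all _ fun u => ?_)
      simp only [smul_eq_mul]
      have : Complex.exp (((2 * π * (w * (s - u)) : ℝ) : ℂ) * Complex.I) =
        Complex.exp (((2 * π * (w * s) : ℝ) : ℂ) * Complex.I) * Complex.exp (((-2 * π * u * w : ℝ) : ℂ) * Complex.I) := by
        rw [← Complex.exp_add]; congr 1; push_cast; ring
      rw [this]; ring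
    · have h2 : Integrable (fun z : ℝ × ℝ => (p z.1 : ℂ) * psi p z.2 ^ (k + 2)) (volume.prod volume) :=
        hp.integrable.ofReal.mul_prod (hp.psi_pow_integrable k)
      refine h2.mono ?_ (ae_of_all _ fun z => ?_)
      · have c1 := hp.psi_cont
        have c2 := hp.cont
        refine Continuous.aestronglyMeasurable ?_
        unfold Function.uncurry
        fun_prop
      · simp only [Function.uncurry, norm_mul, Complex.norm_exp_ofReal_mul_I, one_mul]
        rw [mul_comm]

lemma scaled_bound (hp : GoodDens p) : ∃ c > 0, ∀ (k : ℕ) (t : ℝ),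
    ‖psi p (t / √((k + 2 : ℕ) : ℝ)) ^ (k + 2)‖ ≤ 1 / (1 + c * t ^ 2) := by
  obtain ⟨c, hc, h⟩ := hp.psi_bound
  refine ⟨c / 2, by positivity, fun k t => ?_⟩
  set N : ℝ := ((k + 2 : ℕ) : ℝ) with hN
  have hN2 : 2 ≤ N := by rw [hN]; push_cast; linarith [(Nat.cast_nonneg k : (0:ℝ) ≤ k)]
  have h1 := h (t / √N)
  rw [div_pow, Real.sq_sqrt (by linarith)] at h1
  have hn := norm_nonneg (psi p (t / √N))
  have h2 : ‖psi p (t / √N)‖ ^ (k + 2) = (‖psi p (t / √N)‖ ^ 2) ^ (N / 2) := by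
    rw [← Real.rpow_natCast _ 2, ← Real.rpow_mul hn, ← Real.rpow_natCast]
    congr 1
    rw [← hN]; push_cast; ring
  have hx : 0 ≤ c * (t ^ 2 / N) := by positivity
  have h3 := one_add_mul_self_le_rpow_one_add (s := c * (t ^ 2 / N)) (by linarith) (p := N / 2) (by linarith)
  have h4 : N / 2 * (c * (t ^ 2 / N)) = c / 2 * t ^ 2 := by field_simp
  rw [h4] at h3
  rw [norm_pow, h2]
  calc (‖psi p (t / √N)‖ ^ 2) ^ (N / 2) ≤ (1 / (1 + c * (t ^ 2 / N))) ^ (N / 2) := by gcongr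
    _ = 1 / (1 + c * (t ^ 2 / N)) ^ (N / 2) := by
        rw [Real.div_rpow (by norm_num) (by linarith), Real.one_rpow]
    _ ≤ _ := by gcongr

lemma upper (hp : GoodDens p) : ∃ A > 0, ∀ (k : ℕ) (s : ℝ), cv p k s ≤ A / √((k : ℝ) + 1) := by
  obtain ⟨A0, hA0, hA⟩ := hp.bdd
  obtain ⟨c, hc, hb⟩ := hp.scaled_bound
  set I0 := ∫ t : ℝ, 1 / (1 + c * t ^ 2)
  refine ⟨max A0 I0, lt_max_of_lt_left hA0, fun k s => ?_⟩
  rcases k with _ | k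
  · simp only [Nat.cast_zero, zero_add, Real.sqrt_one, div_one]
    exact (hA s).trans (le_max_left _ _)
  · have hs : 0 < √((k + 2 : ℕ) : ℝ) := Real.sqrt_pos.2 (by positivity)
    have h1 : cv p (k + 1) s ≤ ∫ w, ‖psi p w ^ (k + 2)‖ := by
      have := hp.inversion k s
      have h2 : |cv p (k+1) s| = ‖(cv p (k + 1) s : ℂ)‖ := by rw [Complex.norm_real, Real.norm_eq_abs]
      refine (le_abs_self _).trans ?_
      rw [h2, this]
      refine (norm_integral_le_integral_norm _).trans (le_of_eq ?_)
      refine integral_congr_ae (ae_of_all _ fun u => ?_)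
      simp only [norm_mul, Complex.norm_exp_ofReal_mul_I, one_mul]
    have h2 := Measure.integral_comp_div (fun w => ‖psi p w ^ (k + 2)‖) (√((k + 2 : ℕ) : ℝ))
    rw [abs_of_pos hs, smul_eq_mul] at h2
    have h3 : ∫ t, ‖psi p (t / √((k + 2 : ℕ) : ℝ)) ^ (k + 2)‖ ≤ I0 := by
      refine integral_mono_of_nonneg (ae_of_all _ fun _ => norm_nonneg _) (integrable_cauchy hc) (ae_of_all _ fun t => hb k t)
    have e : ((k + 1 : ℕ) : ℝ) + 1 = ((k + 2 : ℕ) : ℝ) := by push_cast; ring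
    rw [e, le_div_iff₀ hs]
    calc cv p (k + 1) s * √((k + 2 : ℕ) : ℝ) ≤ (∫ w, ‖psi p w ^ (k + 2)‖) * √((k + 2 : ℕ) : ℝ) := by gcongr
      _ = ∫ t, ‖psi p (t / √((k + 2 : ℕ) : ℝ)) ^ (k + 2)‖ := by rw [h2, mul_comm]
      _ ≤ _ := h3.trans (le_max_right _ _)

lemma lower (hp : GoodDens p) : ∃ B > 0, ∀ (k : ℕ), B / √((k : ℝ) + 1) ≤ cv p k 0 := by
  have := hp.isProb
  obtain ⟨A0, hA0, hA⟩ := hp.bdd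
  obtain ⟨c, hc, hb⟩ := hp.scaled_bound
  obtain ⟨σ, hσ, h0, h1, h2⟩ := hp.norm_facts
  have hpos : ∀ k : ℕ, 0 < √((k : ℝ) + 1) * cv p k 0 := fun k =>
    mul_pos (Real.sqrt_pos.2 (by positivity)) ((hp.cv_props hA k).2.1 0)
  have hlim : Tendsto (fun k : ℕ => ∫ t, psi p (t / √((k + 2 : ℕ) : ℝ)) ^ (k + 2)) atTop
      (nhds (∫ t : ℝ, Complex.exp (- ((-(2 * π * t) * σ : ℝ) : ℂ) ^ 2 / 2))) := by
    refine tendsto_integral_of_dominated_convergence (fun t => 1 / (1 + c * t ^ 2)) ?_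
      (integrable_cauchy hc) (fun k => ae_of_all _ fun t => hb k t) (ae_of_all _ fun t => ?_)
    · intro k
      exact ((hp.psi_cont.comp (continuous_id.div_const _)).pow _).aestronglyMeasurable
    · have h3 := ProbabilityTheory.tendsto_charFun_inv_sqrt_mul_pow (P := densMeas p)
        (X := fun u : ℝ => σ⁻¹ * u) (by fun_prop) h0 h1 (-(2 * π * t) * σ)
      have h4 := h3.comp (tendsto_add_atTop_nat 2)
      refine h4.congr fun k => ?_
      simp only [Function.comp]
      rw [h2]
      congr 2
      ring
  have hL : (∫ t : ℝ, Complex.exp (- ((-(2 * π * t) * σ : ℝ) : ℂ) ^ 2 / 2)) =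
      ((∫ t : ℝ, Real.exp (-(2 * (π * σ) ^ 2) * t ^ 2) : ℝ) : ℂ) := by
    rw [← integral_complex_ofReal]
    refine integral_congr_ae (ae_of_all _ fun u => ?_)
    simp only
    rw [Complex.ofReal_exp]; congr 1; push_cast; ring
  set L := ∫ t : ℝ, Real.exp (-(2 * (π * σ) ^ 2) * t ^ 2) with hLdef
  have hLpos : 0 < L := by
    rw [hLdef, integral_gaussian]; positivity
  rw [hL] at hlim
  have hlim' : Tendsto (fun k : ℕ => √(((k + 1 : ℕ) : ℝ) + 1) * cv p (k + 1) 0) atTop (nhds L) := by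
    have h3 := (Complex.continuous_re.tendsto _).comp hlim
    rw [Complex.ofReal_re] at h3
    refine h3.congr fun k => ?_
    have hs : 0 < √((k + 2 : ℕ) : ℝ) := Real.sqrt_pos.2 (by positivity)
    have h5 := Measure.integral_comp_div (fun w => psi p w ^ (k + 2)) (√((k + 2 : ℕ) : ℝ))
    have h6 := hp.inversion k 0
    simp only [mul_zero, Complex.ofReal_zero, zero_mul, Complex.exp_zero, one_mul] at h6
    have e : ((k + 1 : ℕ) : ℝ) + 1 = ((k + 2 : ℕ) : ℝ) := by push_cast; ring
    rw [abs_of_pos hs, ← h6] at h5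
    simp only [Function.comp]
    rw [h5, e]
    simp
  have hlim'' := (tendsto_add_atTop_iff_nat (f := fun k : ℕ => √((k : ℝ) + 1) * cv p k 0) 1).1 hlim'
  have hinv := hlim''.inv₀ hLpos.ne'
  obtain ⟨M, hM⟩ := hinv.bddAbove_range
  have hM' : ∀ k : ℕ, (√((k : ℝ) + 1) * cv p k 0)⁻¹ ≤ M := fun k => hM ⟨k, rfl⟩
  have hM0 : 0 < M := lt_of_lt_of_le (inv_pos.2 (hpos 0)) (hM' 0)
  refine ⟨M⁻¹, inv_pos.2 hM0, fun k => ?_⟩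
  rw [div_le_iff₀ (Real.sqrt_pos.2 (by positivity)), mul_comm]
  exact inv_le_of_inv_le₀ (hpos k) (hM' k)

end GoodDens


lemma measurable_snoc (M : ℕ) : Measurable
    (fun z : (Fin M → ℝ) × ℝ => (Fin.snoc z.1 z.2 : Fin (M + 1) → ℝ)) := by
  refine measurable_pi_lambda _ fun i => ?_
  refine Fin.lastCases ?_ (fun j => ?_) i
  · simp only [Fin.snoc_last]; exact measurable_snd
  · simp only [Fin.snoc_castSucc]; exact (measurable_pi_apply j).comp measurable_fst

lemma lintegral_pi_snoc (μ : Measure ℝ) [SigmaFinite μ] (M : ℕ)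
    (G : (Fin (M + 1) → ℝ) → ENNReal) (hG : Measurable G) :
    ∫⁻ η, G η ∂(Measure.pi fun _ : Fin (M + 1) => μ) =
      ∫⁻ η, ∫⁻ u, G (Fin.snoc η u) ∂μ ∂(Measure.pi fun _ : Fin M => μ) := by
  have h := (measurePreserving_piFinSuccAbove (fun _ : Fin (M + 1) => μ) (Fin.last M)).symm
  rw [← h.lintegral_comp hG, lintegral_prod_symm']
  · refine lintegral_congr fun η => lintegral_congr fun u => ?_
    congr 1
    simp [MeasurableEquiv.piFinSuccAbove_symm_apply, Fin.insertNthEquiv]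
  · exact hG.comp (MeasurableEquiv.measurable _)

lemma lintegral_pi_withDensity (q : ℝ → ENNReal) (hq : Measurable q)
    [SigmaFinite ((volume : Measure ℝ).withDensity q)] (M : ℕ) :
    ∀ (H : (Fin M → ℝ) → ENNReal), Measurable H →
    ∫⁻ η, H η ∂(Measure.pi fun _ : Fin M => (volume : Measure ℝ).withDensity q) =
      ∫⁻ η, (∏ k, q (η k)) * H η := by
  induction M with
  | zero =>
    intro H hH
    rw [volume_pi, Measure.pi_of_empty, Measure.pi_of_empty]
    simp
  | succ M ih =>
    intro H hH
    have hs := measurable_snoc M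
    rw [lintegral_pi_snoc _ _ _ hH, ih, volume_pi, volume_pi, lintegral_pi_snoc (volume : Measure ℝ)]
    · refine lintegral_congr fun η => ?_
      rw [lintegral_withDensity_eq_lintegral_mul _ hq, ← lintegral_const_mul]
      · refine lintegral_congr fun u => ?_
        simp [Fin.prod_univ_castSucc, mul_assoc]
      · exact hq.mul (hH.comp (hs.comp measurable_prodMk_left))
      · exact hH.comp (hs.comp measurable_prodMk_left)
    · exact (Finset.measurable_prod _ fun i _ => hq.comp (measurable_pi_apply i)).mul hH
    · exact Measurable.lintegral_prod_right' (f := fun z : (Fin M → ℝ) × ℝ => H (Fin.snoc z.1 z.2)) (hH.comp hs)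

lemma snoc_sum {M : ℕ} (η : Fin M → ℝ) (u : ℝ) :
    ∑ k, (Fin.snoc η u : Fin (M + 1) → ℝ) k = ∑ k, η k + u := by
  simp [Fin.sum_univ_castSucc]

namespace GoodDens
variable {p : ℝ → ℝ}

lemma cv_meas (hp : GoodDens p) (k : ℕ) : Measurable (cv p k) := by
  obtain ⟨A, _, hA⟩ := hp.bdd
  exact (hp.cv_props hA k).1.measurable

lemma cv_pos (hp : GoodDens p) (k : ℕ) (s : ℝ) : 0 < cv p k s := by
  obtain ⟨A, _, hA⟩ := hp.bdd
  exact (hp.cv_props hA k).2.1 s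

lemma step (hp : GoodDens p) (k : ℕ) (s : ℝ) :
    ∫⁻ u, ENNReal.ofReal (cv p k (-(s + u))) ∂(densMeas p) = ENNReal.ofReal (cv p (k + 1) (-s)) := by
  obtain ⟨A, _, hA⟩ := hp.bdd
  obtain ⟨h1, h2, h3⟩ := hp.cv_props hA k
  have hintg : Integrable (fun u => cv p k (-s - u) * p u) := by
    refine (hp.integrable.const_mul A).mono' ?_ ?_
    · exact ((h1.comp (continuous_const.sub continuous_id)).mul hp.cont).aestronglyMeasurable
    · refine ae_of_all _ fun u => ?_
      rw [Real.norm_of_nonneg (mul_nonneg (h2 _).le (hp.pos u).le)]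
      exact mul_le_mul_of_nonneg_right (h3 _) (hp.pos u).le
  show _ = ENNReal.ofReal (∫ u, cv p k (-s - u) * p u)
  rw [ofReal_integral_eq_lintegral_ofReal hintg
    (ae_of_all _ fun u => (mul_pos (h2 _) (hp.pos u)).le), densMeas,
    lintegral_withDensity_eq_lintegral_mul _ hp.cont.measurable.ennreal_ofReal]
  · refine lintegral_congr fun u => ?_
    rw [ENNReal.ofReal_mul (h2 _).le, Pi.mul_apply, mul_comm, neg_add, sub_eq_add_neg]
  · exact (h1.measurable.comp (by fun_prop)).ennreal_ofReal

lemma peel (hp : GoodDens p) {M : ℕ} (F : (Fin (M + 1) → ℝ) → ENNReal) (hF : Measurable F)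
    (hdep : ∀ (η : Fin M → ℝ) u v, F (Fin.snoc η u) = F (Fin.snoc η v)) (h : ℝ → ENNReal)
    (hh : Measurable h) :
    ∫⁻ η, F η * h (∑ k, η k) ∂(Measure.pi fun _ : Fin (M + 1) => densMeas p) =
      ∫⁻ η, F (Fin.snoc η 0) * ∫⁻ u, h (∑ k, η k + u) ∂(densMeas p)
        ∂(Measure.pi fun _ : Fin M => densMeas p) := by
  have := hp.isProb
  rw [lintegral_pi_snoc]
  · refine lintegral_congr fun η => ?_
    rw [← lintegral_const_mul]
    · refine lintegral_congr fun u => ?_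
      rw [snoc_sum, hdep η u 0]
    · exact hh.comp (by fun_prop)
  · exact hF.mul (hh.comp (by fun_prop))

lemma iter (hp : GoodDens p) (n : ℕ) {K : ℝ} (k : ℕ) : ∀ (j : ℕ), (∀ s, cv p (j + k) s ≤ K) →
    ∀ (F : (Fin (n + k) → ℝ) → ENNReal), Measurable F →
    (∀ η η' : Fin (n + k) → ℝ, (∀ i : Fin (n + k), (i : ℕ) < n → η i = η' i) → F η = F η') →
    ∫⁻ η, F η * ENNReal.ofReal (cv p j (-∑ i, η i)) ∂(Measure.pi fun _ : Fin (n + k) => densMeas p) ≤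
      ENNReal.ofReal K * ∫⁻ η, F η ∂(Measure.pi fun _ : Fin (n + k) => densMeas p) := by
  have := hp.isProb
  induction k with
  | zero =>
    intro j hj F hF _
    rw [← lintegral_const_mul _ hF]
    refine lintegral_mono fun η => ?_
    rw [mul_comm]
    gcongr
    exact hj _
  | succ k ih =>
    intro j hj F hF hdep
    have hd : ∀ (η : Fin (n + k) → ℝ) u v, F (Fin.snoc η u : Fin (n + k + 1) → ℝ)
        = F (Fin.snoc η v : Fin (n + k + 1) → ℝ) := by
      intro η u v
      refine hdep _ _ fun i => ?_
      refine Fin.lastCases (n := n + k) ?_ (fun j => ?_) i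
      · intro h; simp at h
      · intro; rw [Fin.snoc_castSucc, Fin.snoc_castSucc]
    have h1 := peel hp (M := n + k) F hF hd (fun s => ENNReal.ofReal (cv p j (-s)))
      ((hp.cv_meas j).comp measurable_neg).ennreal_ofReal
    have h2 := peel hp (M := n + k) F hF hd (fun s => 1) measurable_const
    simp only [mul_one, lintegral_const, measure_univ] at h2
    simp only [hp.step] at h1
    refine (le_of_eq h1).trans ?_
    refine le_trans ?_ (le_of_eq (congrArg _ h2.symm))
    refine ih (j + 1) ?_ (fun η => F (Fin.snoc η 0 : Fin (n + k + 1) → ℝ)) ?_ ?_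
    · intro s
      have := hj s
      rwa [show j + 1 + k = j + (k + 1) by ring]
    · exact hF.comp ((measurable_snoc (n + k)).comp measurable_prodMk_right)
    · intro η η' h
      refine hdep _ _ fun i => ?_
      refine Fin.lastCases (n := n + k) ?_ (fun j => ?_) i
      · intro h; simp at h
      · intro hj; rw [Fin.snoc_castSucc, Fin.snoc_castSucc]; exact h j (by simpa using hj)

lemma total (hp : GoodDens p) (M : ℕ) : ∀ (j : ℕ),
    ∫⁻ η, ENNReal.ofReal (cv p j (-∑ i, η i)) ∂(Measure.pi fun _ : Fin M => densMeas p) =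
      ENNReal.ofReal (cv p (j + M) 0) := by
  have := hp.isProb
  induction M with
  | zero => intro j; rw [Measure.pi_of_empty]; simp
  | succ M ih =>
    intro j
    have h1 := peel hp (M := M) (fun _ => 1) measurable_const (fun _ _ _ => rfl)
      (fun s => ENNReal.ofReal (cv p j (-s))) ((hp.cv_meas j).comp measurable_neg).ennreal_ofReal
    simp only [one_mul, hp.step] at h1
    rw [h1, ih, show j + 1 + M = j + (M + 1) by ring]

end GoodDens


def Dmap (M : ℕ) (y : Fin M → ℝ) : Fin M → ℝ := fun k =>
  conf (M + 1) y (k + 1) - conf (M + 1) y k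

lemma conf_snoc (M : ℕ) (y : Fin M → ℝ) (u : ℝ) (j : ℕ) (hj : j ≤ M) :
    conf (M + 2) (Fin.snoc y u : Fin (M + 1) → ℝ) j = conf (M + 1) y j := by
  unfold conf
  by_cases h : 1 ≤ j
  · have h1 : 1 ≤ j ∧ j ≤ M + 2 - 1 := ⟨h, by omega⟩
    have h2 : 1 ≤ j ∧ j ≤ M + 1 - 1 := ⟨h, by omega⟩
    rw [dif_pos h1, dif_pos h2]
    exact Fin.snoc_castSucc (α := fun _ => ℝ) (n := M) u y ⟨j - 1, by omega⟩
  · rw [dif_neg (by omega), dif_neg (by omega)]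

lemma conf_snoc_last (M : ℕ) (y : Fin M → ℝ) (u : ℝ) :
    conf (M + 2) (Fin.snoc y u : Fin (M + 1) → ℝ) (M + 1) = u := by
  unfold conf
  rw [dif_pos ⟨by omega, by omega⟩]
  exact Fin.snoc_last (α := fun _ => ℝ) (n := M) u y

lemma conf_zero (N : ℕ) (y : Fin (N - 1) → ℝ) : conf N y 0 = 0 := by simp [conf]

lemma conf_last (M : ℕ) (y : Fin M → ℝ) : conf (M + 1) y (M + 1) = 0 := by
  simp [conf]

lemma Dmap_snoc (M : ℕ) (y : Fin M → ℝ) (u : ℝ) :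
    Dmap (M + 1) (Fin.snoc y u) = Fin.snoc (Dmap M y) (u - conf (M + 1) y M) := by
  funext i
  refine Fin.lastCases ?_ (fun j => ?_) i
  · rw [Fin.snoc_last]
    simp only [Dmap, Fin.val_last]
    rw [conf_snoc_last, conf_snoc _ _ _ _ le_rfl]
  · rw [Fin.snoc_castSucc]
    simp only [Dmap, Fin.val_castSucc]
    rw [conf_snoc _ _ _ _ (by omega), conf_snoc _ _ _ _ (by omega)]

lemma measurable_conf (N : ℕ) : Measurable (conf N) := by
  refine measurable_pi_lambda _ fun k => ?_
  unfold conf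
  split_ifs
  · exact measurable_pi_apply _
  · exact measurable_const

lemma measurable_Dmap (M : ℕ) : Measurable (Dmap M) := by
  refine measurable_pi_lambda _ fun k => ?_
  have h : ∀ j, Measurable fun y : Fin M → ℝ => conf (M + 1) y j := fun j =>
    measurable_pi_iff.1 (measurable_conf (M + 1)) j
  exact (h _).sub (h _)

lemma lintegral_Dmap (M : ℕ) : ∀ (G : (Fin M → ℝ) → ENNReal), Measurable G →
    ∫⁻ y, G (Dmap M y) = ∫⁻ η, G η := by
  induction M with
  | zero => intro G hG; refine lintegral_congr fun y => ?_; congr 1; exact Subsingleton.elim _ _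
  | succ M ih =>
    intro G hG
    have hs := measurable_snoc M
    rw [volume_pi, lintegral_pi_snoc _ _ (fun y => G (Dmap (M + 1) y))
      (hG.comp (measurable_Dmap _)), lintegral_pi_snoc _ _ _ hG]
    have : ∀ y : Fin M → ℝ, ∫⁻ u, G (Dmap (M + 1) (Fin.snoc y u)) =
        ∫⁻ u, G (Fin.snoc (Dmap M y) u) := by
      intro y
      simp only [Dmap_snoc]
      exact lintegral_sub_right_eq_self (fun u => G (Fin.snoc (Dmap M y) u)) _
    simp only [this]
    exact ih (fun η => ∫⁻ u, G (Fin.snoc η u))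
      (Measurable.lintegral_prod_right' (f := fun z : (Fin M → ℝ) × ℝ => G (Fin.snoc z.1 z.2)) (hG.comp hs))

lemma sum_Dmap (M : ℕ) (y : Fin M → ℝ) : ∑ k, Dmap M y k = conf (M + 1) y M := by
  have := Finset.sum_range_sub (conf (M + 1) y) M
  rw [conf_zero, sub_zero] at this
  rw [← this, Finset.sum_range]
  rfl

lemma incr_conf (M : ℕ) (y : Fin M → ℝ) :
    incr (M + 1) (conf (M + 1) y) = Fin.snoc (Dmap M y) (-∑ k, Dmap M y k) := by
  funext i
  refine Fin.lastCases ?_ (fun j => ?_) i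
  · rw [Fin.snoc_last, sum_Dmap]
    simp only [incr, Fin.val_last]
    rw [conf_last, zero_sub]
  · rw [Fin.snoc_castSucc]
    simp only [incr, Dmap, Fin.val_castSucc]

lemma exp_Ham (V p : ℝ → ℝ) (lam z : ℝ) (hz : 0 < z) (hpV : ∀ u, p u = exp (-(V u - lam * u)) / z)
    (M : ℕ) (y : Fin M → ℝ) :
    exp (-(Ham V (M + 1) (conf (M + 1) y))) =
      z ^ (M + 1) * ((∏ k, p (Dmap M y k)) * p (-∑ k, Dmap M y k)) := by
  have h1 : Ham V (M + 1) (conf (M + 1) y) =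
      ∑ k ∈ Finset.range (M + 1), (V (conf (M + 1) y (k + 1) - conf (M + 1) y k)
        - lam * (conf (M + 1) y (k + 1) - conf (M + 1) y k)) := by
    rw [Finset.sum_sub_distrib, ← Finset.mul_sum, Finset.sum_range_sub, conf_last, conf_zero]
    simp [Ham]
  have h2 : ∀ u, exp (-(V u - lam * u)) = z * p u := fun u => by
    rw [hpV]; field_simp
  rw [h1, ← Finset.sum_neg_distrib, exp_sum]
  simp only [h2]
  rw [Finset.prod_mul_distrib, Finset.prod_const, Finset.card_range, Finset.prod_range_succ,
    Finset.prod_range, sum_Dmap, conf_last, zero_sub]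
  rfl

namespace GoodDens
variable {p : ℝ → ℝ}

lemma pi_lintegral (hp : GoodDens p) (M : ℕ) (H : (Fin M → ℝ) → ENNReal) (hH : Measurable H) :
    ∫⁻ η, H η ∂(Measure.pi fun _ : Fin M => densMeas p) =
      ∫⁻ y, ENNReal.ofReal (∏ k, p (Dmap M y k)) * H (Dmap M y) := by
  have := hp.isProb
  unfold densMeas at *
  rw [lintegral_pi_withDensity _ hp.cont.measurable.ennreal_ofReal _ _ hH]
  have h3 := lintegral_Dmap M (fun η => (∏ k, ENNReal.ofReal (p (η k))) * H η)
    ((Finset.measurable_prod _ fun i _ =>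
      hp.cont.measurable.ennreal_ofReal.comp (measurable_pi_apply i)).mul hH)
  rw [← h3]
  refine lintegral_congr fun y => ?_
  rw [ENNReal.ofReal_prod_of_nonneg fun i _ => (hp.pos _).le]

lemma Zpart_eq (hp : GoodDens p) (V : ℝ → ℝ) (lam z : ℝ) (hz : 0 < z)
    (hpV : ∀ u, p u = exp (-(V u - lam * u)) / z) (M : ℕ) :
    Zpart V (M + 1) = z ^ (M + 1) * cv p M 0 := by
  unfold Zpart
  show (∫ y : Fin M → ℝ, exp (-(Ham V (M + 1) (conf (M + 1) y)))) = _
  simp only [exp_Ham V p lam z hz hpV]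
  rw [integral_const_mul]
  congr 1
  have hm : Measurable fun y : Fin M → ℝ => (∏ k, p (Dmap M y k)) * p (-∑ k, Dmap M y k) := by
    have h := measurable_Dmap M
    have hpm := hp.cont.measurable
    have h1 : Measurable fun η : Fin M → ℝ => (∏ k, p (η k)) * p (-∑ k, η k) :=
      (Finset.measurable_prod _ fun i _ => hpm.comp (measurable_pi_apply i)).mul
        (hpm.comp (by fun_prop))
    exact h1.comp h
  rw [integral_eq_lintegral_of_nonneg_ae]
  · have h := hp.total M 0
    rw [hp.pi_lintegral] at h
    · rw [zero_add] at h
      rw [← ENNReal.toReal_ofReal (hp.cv_pos M 0).le, ← h]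
      congr 1
      refine lintegral_congr fun y => ?_
      rw [ENNReal.ofReal_mul (Finset.prod_nonneg fun i _ => (hp.pos _).le)]
      rfl
    · exact ((hp.cv_meas 0).comp (by fun_prop)).ennreal_ofReal
  · exact ae_of_all _ fun y => mul_nonneg (Finset.prod_nonneg fun i _ => (hp.pos _).le) (hp.pos _).le
  · exact hm.aestronglyMeasurable

lemma lhs_eq (hp : GoodDens p) (V : ℝ → ℝ) (lam z : ℝ) (hz : 0 < z)
    (hpV : ∀ u, p u = exp (-(V u - lam * u)) / z) (M : ℕ)
    (f : (Fin (M + 1) → ℝ) → ℝ) (hf : Measurable f) (hf0 : ∀ η, 0 ≤ f η)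
    (hdep : ∀ (η : Fin M → ℝ) u v, f (Fin.snoc η u) = f (Fin.snoc η v)) :
    ∫ x, f (incr (M + 1) x) ∂piN V (M + 1) =
      ((ENNReal.ofReal (cv p M 0))⁻¹ *
        ∫⁻ η, ENNReal.ofReal (f (Fin.snoc η 0)) * ENNReal.ofReal (cv p 0 (-∑ i, η i))
        ∂(Measure.pi fun _ : Fin M => densMeas p)).toReal := by
  have hi : Measurable (incr (M + 1)) :=
    measurable_pi_lambda _ fun k => (measurable_pi_apply _).sub (measurable_pi_apply _)
  have hmd : Measurable fun y : Fin M → ℝ =>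
      ENNReal.ofReal (exp (-(Ham V (M + 1) (conf (M + 1) y))) / Zpart V (M + 1)) := by
    simp only [exp_Ham V p lam z hz hpV]
    have h := measurable_Dmap M
    have hpm := hp.cont.measurable
    have h1 : Measurable fun η : Fin M → ℝ => (∏ k, p (η k)) * p (-∑ k, η k) :=
      (Finset.measurable_prod _ fun i _ => hpm.comp (measurable_pi_apply i)).mul
        (hpm.comp (by fun_prop))
    exact (((h1.comp h).const_mul _).div_const _).ennreal_ofReal
  rw [integral_eq_lintegral_of_nonneg_ae (ae_of_all _ fun x => hf0 _)
    (hf.comp hi).aestronglyMeasurable]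
  congr 1
  unfold piN
  rw [lintegral_map (f := fun x => ENNReal.ofReal (f (incr (M + 1) x)))
    (hf.comp hi).ennreal_ofReal (measurable_conf _)]
  have e := lintegral_withDensity_eq_lintegral_mul (volume : Measure (Fin M → ℝ)) hmd
    (g := fun y => ENNReal.ofReal (f (incr (M + 1) (conf (M + 1) y))))
    ((hf.comp hi).comp (measurable_conf (M + 1))).ennreal_ofReal
  refine e.trans ?_
  have hsn : Measurable fun η : Fin M → ℝ => f (Fin.snoc η 0 : Fin (M + 1) → ℝ) :=
    hf.comp ((measurable_snoc M).comp measurable_prodMk_right)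
  have hc : Measurable fun η : Fin M → ℝ => ENNReal.ofReal (cv p 0 (-∑ i, η i)) :=
    ((hp.cv_meas 0).comp (by fun_prop)).ennreal_ofReal
  rw [hp.pi_lintegral M (fun η => ENNReal.ofReal (f (Fin.snoc η 0)) * ENNReal.ofReal (cv p 0 (-∑ i, η i))) (hsn.ennreal_ofReal.mul hc), ← lintegral_const_mul]
  · refine lintegral_congr fun y => ?_
    have hP : 0 ≤ ∏ k, p (Dmap M y k) := Finset.prod_nonneg fun i _ => (hp.pos _).le
    have hcv := hp.cv_pos M 0
    rw [Pi.mul_apply, exp_Ham V p lam z hz hpV, hp.Zpart_eq V lam z hz hpV, incr_conf,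
      hdep _ _ 0, mul_div_mul_left _ _ (by positivity), ENNReal.ofReal_div_of_pos hcv,
      ENNReal.ofReal_mul hP, div_eq_mul_inv]
    show _ = (ENNReal.ofReal (cv p M 0))⁻¹ * (ENNReal.ofReal (∏ k, p (Dmap M y k)) *
      (ENNReal.ofReal (f (Fin.snoc (Dmap M y) 0)) * ENNReal.ofReal (p (-∑ i, Dmap M y i))))
    ring
  · exact ((Finset.measurable_prod _ fun i _ => hp.cont.measurable.comp
      ((measurable_pi_apply i).comp (measurable_Dmap M))).ennreal_ofReal).mul
      ((hsn.ennreal_ofReal.mul hc).comp (measurable_Dmap M))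

lemma compare (hp : GoodDens p) (V : ℝ → ℝ) (lam z : ℝ) (hz : 0 < z)
    (hpV : ∀ u, p u = exp (-(V u - lam * u)) / z) (a : ℝ) (ha0 : 0 < a) (ha1 : a < 1) :
    ∃ Ca > (0 : ℝ), ∀ N : ℕ, 1 ≤ N →
        ∀ f : (Fin N → ℝ) → ℝ, Measurable f → (∀ η, 0 ≤ f η) → (∃ M : ℝ, ∀ η, f η ≤ M) →
          (∀ η η' : Fin N → ℝ, (∀ k : Fin N, (k : ℕ) < Nat.floor (a * N) → η k = η' k) →
            f η = f η') →
          (∫ x, f (incr N x) ∂piN V N) ≤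
            Ca * ∫ η, f η ∂(Measure.pi fun _ : Fin N => densMeas p) := by
  have := hp.isProb
  obtain ⟨A, hA, hup⟩ := hp.upper
  obtain ⟨B, hB, hlo⟩ := hp.lower
  have h1a : 0 < 1 - a := by linarith
  refine ⟨A / (B * √(1 - a)), by positivity, ?_⟩
  intro N hN f hf hf0 hfb hdep
  obtain ⟨n, hn⟩ : ∃ n, n = Nat.floor (a * N) := ⟨_, rfl⟩
  rw [← hn] at hdep
  have hN0 : (0 : ℝ) < N := by exact_mod_cast hN
  have hnle : (n : ℝ) ≤ a * N := by rw [hn]; exact Nat.floor_le (by positivity)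
  have hnN : n < N := by
    have : (n : ℝ) < N := by nlinarith
    exact_mod_cast this
  obtain ⟨k, rfl⟩ : ∃ k, N = n + k + 1 := ⟨N - n - 1, by omega⟩
  clear hn
  have hd : ∀ (η : Fin (n + k) → ℝ) u v, f (Fin.snoc η u) = f (Fin.snoc η v) := by
    intro η u v
    refine hdep _ _ fun i => ?_
    refine Fin.lastCases ?_ (fun j => ?_) i
    · intro h
      rw [Fin.val_last] at h
      omega
    · intro; rw [Fin.snoc_castSucc, Fin.snoc_castSucc]
  have hsn : Measurable fun η : Fin (n + k) → ℝ => f (Fin.snoc η 0 : Fin (n + k + 1) → ℝ) :=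
    hf.comp ((measurable_snoc (n + k)).comp measurable_prodMk_right)
  have h1 := hp.iter n k 0 (K := A / √((k : ℝ) + 1)) (by rw [zero_add]; exact hup k)
    (fun η => ENNReal.ofReal (f (Fin.snoc η 0))) hsn.ennreal_ofReal (by
      intro η η' h
      congr 1
      refine hdep _ _ fun i => ?_
      refine Fin.lastCases ?_ (fun j => ?_) i
      · intro h
        rw [Fin.val_last] at h
        omega
      · intro hj; rw [Fin.snoc_castSucc, Fin.snoc_castSucc]; exact h j (by simpa using hj))
  have h2 := peel hp (M := n + k) (fun η => ENNReal.ofReal (f η)) hf.ennreal_ofReal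
    (fun η u v => by rw [hd η u v]) (fun s => 1) measurable_const
  simp only [mul_one, lintegral_const, measure_univ] at h2
  rw [← h2] at h1
  rw [hp.lhs_eq V lam z hz hpV _ f hf hf0 hd, integral_eq_lintegral_of_nonneg_ae
    (ae_of_all _ fun x => hf0 _) hf.aestronglyMeasurable]
  have hfin : ∫⁻ η, ENNReal.ofReal (f η) ∂(Measure.pi fun _ : Fin (n + k + 1) => densMeas p) ≠ ⊤ := by
    obtain ⟨R, hR⟩ := hfb
    refine ne_top_of_le_ne_top (b := ENNReal.ofReal R) ENNReal.ofReal_ne_top ?_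
    calc _ ≤ ∫⁻ η, ENNReal.ofReal R ∂(Measure.pi fun _ : Fin (n + k + 1) => densMeas p) :=
          lintegral_mono fun η => ENNReal.ofReal_le_ofReal (hR η)
      _ = _ := by simp
  set I := ∫⁻ η, ENNReal.ofReal (f η) ∂(Measure.pi fun _ : Fin (n + k + 1) => densMeas p) with hI
  have hcv := hp.cv_pos (n + k) 0
  have h3 : (ENNReal.ofReal (cv p (n + k) 0))⁻¹ * (ENNReal.ofReal (A / √((k : ℝ) + 1)) * I) ≠ ⊤ := by
    refine ENNReal.mul_ne_top ?_ (ENNReal.mul_ne_top ENNReal.ofReal_ne_top hfin)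
    simp [hcv]
  refine (ENNReal.toReal_mono h3 (mul_le_mul_right h1 _)).trans ?_
  rw [ENNReal.toReal_mul, ENNReal.toReal_mul, ENNReal.toReal_inv, ENNReal.toReal_ofReal hcv.le,
    ENNReal.toReal_ofReal (by positivity), ← mul_assoc]
  refine mul_le_mul_of_nonneg_right ?_ ENNReal.toReal_nonneg
  have hl := hlo (n + k)
  push_cast at hnle hl hN0
  have h4 : √(1 - a) * √((n : ℝ) + k + 1) ≤ √((k : ℝ) + 1) := by
    rw [← Real.sqrt_mul h1a.le]
    exact Real.sqrt_le_sqrt (by nlinarith)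
  have hs1 : 0 < √((n : ℝ) + k + 1) := Real.sqrt_pos.2 hN0
  have hs2 : 0 < √((k : ℝ) + 1) := by positivity
  have hs3 : 0 < √(1 - a) := Real.sqrt_pos.2 h1a
  have h5 : (cv p (n + k) 0)⁻¹ ≤ √((n : ℝ) + k + 1) / B := by
    rw [inv_le_comm₀ hcv (by positivity), inv_div]; exact hl
  calc (cv p (n + k) 0)⁻¹ * (A / √((k : ℝ) + 1))
      ≤ √((n : ℝ) + k + 1) / B * (A / √((k : ℝ) + 1)) := by gcongr
    _ ≤ A / (B * √(1 - a)) := by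
      rw [div_mul_div_comm, div_le_div_iff₀ (by positivity) (by positivity)]
      have : 0 < A * B := by positivity
      nlinarith

end GoodDens


lemma convex_cont {V : ℝ → ℝ} (hV : ConvexOn ℝ Set.univ V) : Continuous V :=
  continuousOn_univ.1 (hV.continuousOn isOpen_univ)

lemma lower_lin {V : ℝ → ℝ} (hV : ConvexOn ℝ Set.univ V) {lam : ℝ} (h : InSlopeInterval V lam) :
    ∃ ε > 0, ∃ c, ∀ u, ε * |u| - c ≤ V u - lam * u := by
  obtain ⟨vm, vp, hm, hp, h1, h2⟩ := h
  obtain ⟨q, hq1, hq2⟩ := EReal.lt_iff_exists_real_btwn.1 h1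
  obtain ⟨r, hr1, hr2⟩ := EReal.lt_iff_exists_real_btwn.1 h2
  have hq2' : q < lam := by exact_mod_cast hq2
  have hr1' : lam < r := by exact_mod_cast hr1
  have e1 := hm.eventually_lt_const hq1
  have e2 := hp.eventually_const_lt hr2
  obtain ⟨R1, hR1⟩ := eventually_atBot.1 e1
  obtain ⟨R2, hR2⟩ := eventually_atTop.1 e2
  set R := |R1| + |R2| + 1 with hR
  have hRpos : 0 < R := by positivity
  have hc : Continuous fun u => V u - lam * u := (convex_cont hV).sub (by fun_prop)
  obtain ⟨b, hb⟩ := (isCompact_Icc (a := -R) (b := R)).bddBelow_image hc.continuousOn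
  refine ⟨min (r - lam) (lam - q), lt_min (by linarith) (by linarith),
    min (r - lam) (lam - q) * R + |b|, fun u => ?_⟩
  set ε := min (r - lam) (lam - q) with hε
  have hε1 : ε ≤ r - lam := min_le_left _ _
  have hε2 : ε ≤ lam - q := min_le_right _ _
  have hε0 : 0 < ε := lt_min (by linarith) (by linarith)
  have hpos : 0 ≤ ε * R + |b| := by positivity
  rcases lt_or_ge R u with hu | hu
  · have hu0 : 0 < u := hRpos.trans hu
    have : r < V u / u := by
      exact_mod_cast hR2 u (by have := le_abs_self R2; have := abs_nonneg R1; linarith)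
    rw [lt_div_iff₀ hu0] at this
    rw [abs_of_pos hu0]
    nlinarith
  rcases lt_or_ge u (-R) with hu' | hu'
  · have hu0 : u < 0 := by linarith
    have : V u / u < q := by
      exact_mod_cast hR1 u (by have := neg_abs_le R1; have := abs_nonneg R2; linarith)
    rw [div_lt_iff_of_neg hu0] at this
    rw [abs_of_neg hu0]
    nlinarith
  · have h3 : b ≤ V u - lam * u := hb ⟨u, ⟨hu', hu⟩, rfl⟩
    have h4 : |u| ≤ R := abs_le.2 ⟨hu', hu⟩
    have := neg_abs_le b
    nlinarith

lemma tail_int {W h : ℝ → ℝ} (hW : Continuous W) (hh : Continuous h) {ε c : ℝ} (hε : 0 < ε)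
    (hl : ∀ u, ε * |u| - c ≤ W u) (hb : ∀ u, |h u| ≤ 1 + u ^ 2) :
    Integrable fun u => h u * exp (-(W u)) := by
  have hK : ∀ u : ℝ, (1 + u ^ 2) ^ 2 ≤ (2 + 48 / ε ^ 4) * exp (ε * |u|) := by
    intro u
    have h0 : 0 ≤ ε * |u| := by positivity
    have h1 := Real.pow_div_factorial_le_exp (ε * |u|) h0 4
    have h2 := Real.one_le_exp h0
    have h3 : (Nat.factorial 4 : ℝ) = 24 := by norm_num [Nat.factorial]
    have h5 : |u| ^ 4 = u ^ 4 := by rw [← abs_pow, abs_of_nonneg (by positivity)]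
    rw [h3, mul_pow, h5] at h1
    have h4 : 2 * u ^ 4 ≤ 48 / ε ^ 4 * exp (ε * |u|) := by
      calc 2 * u ^ 4 = 48 / ε ^ 4 * (ε ^ 4 * u ^ 4 / 24) := by field_simp; ring
        _ ≤ _ := by gcongr
    nlinarith [sq_nonneg (u ^ 2 - 1)]
  have hi : Integrable fun u : ℝ => exp c * (2 + 48 / ε ^ 4) * (1 + u ^ 2)⁻¹ :=
    integrable_inv_one_add_sq.const_mul _
  refine hi.mono' (hh.mul (Real.continuous_exp.comp hW.neg)).aestronglyMeasurable
    (ae_of_all _ fun u => ?_)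
  rw [norm_mul, Real.norm_eq_abs, Real.norm_of_nonneg (exp_pos _).le]
  have h1 : exp (-(W u)) ≤ exp c * (exp (ε * |u|))⁻¹ := by
    rw [← exp_neg, ← exp_add]; exact exp_le_exp.2 (by linarith [hl u])
  have hp : 0 < 1 + u ^ 2 := by positivity
  calc |h u| * exp (-(W u)) ≤ (1 + u ^ 2) * (exp c * (exp (ε * |u|))⁻¹) := by
        gcongr; exact hb u
    _ = exp c * ((1 + u ^ 2) ^ 2 * (exp (ε * |u|))⁻¹) * (1 + u ^ 2)⁻¹ := by field_simp
    _ ≤ exp c * ((2 + 48 / ε ^ 4)) * (1 + u ^ 2)⁻¹ := by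
        gcongr
        rw [← div_eq_mul_inv, div_le_iff₀ (exp_pos _)]
        exact hK u

lemma good_of_slope {V : ℝ → ℝ} (hV : ConvexOn ℝ Set.univ V) {lam : ℝ} (h : InSlopeInterval V lam)
    (h0 : (∫ u : ℝ, u * Real.exp (-(V u) + lam * u)) = 0) :
    0 < (∫ s : ℝ, exp (-(V s - lam * s))) ∧
    GoodDens fun u => exp (-(V u - lam * u)) / ∫ s : ℝ, exp (-(V s - lam * s)) := by
  obtain ⟨ε, hε, c, hl⟩ := lower_lin hV h
  have hVc := convex_cont hV
  have hc : Continuous fun u => V u - lam * u := hVc.sub (by fun_prop)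
  have hi0 : Integrable fun u => exp (-(V u - lam * u)) := by
    have := tail_int (h := fun _ => 1) hc continuous_const hε hl
      (fun u => by rw [abs_one]; nlinarith [sq_nonneg u])
    simpa using this
  have hi2 : Integrable fun u => u ^ 2 * exp (-(V u - lam * u)) :=
    tail_int (h := fun u => u ^ 2) hc (by fun_prop) hε hl
      (fun u => by rw [abs_of_nonneg (sq_nonneg u)]; linarith)
  have hz : 0 < (∫ s : ℝ, exp (-(V s - lam * s))) := integral_exp_pos hi0
  refine ⟨hz, ?_⟩
  set z := ∫ s : ℝ, exp (-(V s - lam * s)) with hzdef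
  have hcx : ConvexOn ℝ Set.univ fun u => V u - lam * u := by
    refine ⟨convex_univ, fun x _ y _ s t hs ht hst => ?_⟩
    have := hV.2 (Set.mem_univ x) (Set.mem_univ y) hs ht hst
    simp only [smul_eq_mul] at *
    linarith
  have hcoer : Tendsto (fun u => V u - lam * u) (cocompact ℝ) atTop := by
    refine tendsto_atTop_mono hl ?_
    have h1 : Tendsto (fun u : ℝ => |u|) (cocompact ℝ) atTop := tendsto_norm_cocompact_atTop
    exact tendsto_atTop_add_const_right _ _ (h1.const_mul_atTop hε)
  obtain ⟨m, hm⟩ := hc.exists_forall_le hcoer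
  refine ⟨?_, fun u => by positivity, hi0.div_const _, ?_, ?_, ?_, m, ?_, ?_⟩
  · exact (Real.continuous_exp.comp hc.neg).div_const _
  · rw [integral_div, div_self hz.ne']
  · have := hi2.div_const z
    simpa only [mul_div_assoc] using this
  · have : (fun u => u * (exp (-(V u - lam * u)) / z)) = fun u => (u * exp (-(V u) + lam * u)) / z := by
      funext u; rw [mul_div_assoc]; congr 3; ring
    rw [this, integral_div, h0, zero_div]
  · intro x hx y hy hxy
    simp only [Set.mem_Iic] at hx hy
    have := hcx.le_max_of_mem_Icc (Set.mem_univ x) (Set.mem_univ m) ⟨hxy, hy⟩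
    simp only [max_eq_left (hm x)] at this
    simp only
    gcongr
  · intro x hx y hy hxy
    simp only [Set.mem_Ici] at hx hy
    have := hcx.le_max_of_mem_Icc (Set.mem_univ m) (Set.mem_univ y) ⟨hx, hxy⟩
    simp only [max_eq_right (hm y)] at this
    simp only
    gcongr

lemma int_u {V : ℝ → ℝ} (hV : ConvexOn ℝ Set.univ V) {lam : ℝ} (h : InSlopeInterval V lam) :
    Integrable fun u => u * exp (-(V u) + lam * u) := by
  obtain ⟨ε, hε, c, hl⟩ := lower_lin hV h
  have hVc := convex_cont hV
  have hc : Continuous fun u => V u - lam * u := hVc.sub (by fun_prop)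
  have := tail_int (h := fun u => u) hc continuous_id hε hl (fun u => by
    rw [← sq_abs u]; nlinarith [sq_nonneg (|u| - 1), sq_nonneg (|u|)])
  convert this using 4
  ring

lemma mean_strict {V : ℝ → ℝ} (hV : ConvexOn ℝ Set.univ V) {l1 l2 : ℝ} (h1 : InSlopeInterval V l1)
    (h2 : InSlopeInterval V l2) (hlt : l1 < l2) :
    (∫ u : ℝ, u * exp (-(V u) + l1 * u)) < ∫ u : ℝ, u * exp (-(V u) + l2 * u) := by
  rw [← sub_pos, ← integral_sub (int_u hV h2) (int_u hV h1)]
  have hnn : ∀ u : ℝ, 0 ≤ u * exp (-(V u) + l2 * u) - u * exp (-(V u) + l1 * u) := by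
    intro u
    rw [← mul_sub]
    rcases le_total 0 u with h | h
    · refine mul_nonneg h (sub_nonneg.2 (exp_le_exp.2 ?_)); nlinarith
    · refine mul_nonneg_of_nonpos_of_nonpos h (sub_nonpos.2 (exp_le_exp.2 ?_)); nlinarith
  rw [integral_pos_iff_support_of_nonneg hnn ((int_u hV h2).sub (int_u hV h1))]
  refine lt_of_lt_of_le ?_ (measure_mono (s := Set.Ioi (0 : ℝ)) ?_)
  · simp
  · intro u hu
    have hu : 0 < u := hu
    have : exp (-(V u) + l1 * u) < exp (-(V u) + l2 * u) := exp_lt_exp.2 (by nlinarith)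
    simp only [Function.mem_support]
    exact (sub_pos.2 (mul_lt_mul_of_pos_left this hu)).ne'

lemma slope_iff {V : ℝ → ℝ} {vm vp : EReal}
    (hm : Tendsto (fun x : ℝ => ((V x / x : ℝ) : EReal)) atBot (nhds vm))
    (hp : Tendsto (fun x : ℝ => ((V x / x : ℝ) : EReal)) atTop (nhds vp)) (l : ℝ) :
    InSlopeInterval V l ↔ vm < (l : EReal) ∧ (l : EReal) < vp := by
  constructor
  · rintro ⟨a, b, ha, hb, h1, h2⟩
    rw [tendsto_nhds_unique hm ha, tendsto_nhds_unique hp hb]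
    exact ⟨h1, h2⟩
  · rintro ⟨h1, h2⟩
    exact ⟨vm, vp, hm, hp, h1, h2⟩

lemma piece {V : ℝ → ℝ} (hV : ConvexOn ℝ Set.univ V) {l0 l : ℝ} (h0 : InSlopeInterval V l0)
    (h : InSlopeInterval V l) (hle : l0 ≤ l) {S : Set ℝ} (hS : MeasurableSet S)
    (hS0 : S ⊆ Set.Ioi 0)
    (hK : -(∫ u in Set.Iic 0, u * exp (-(V u) + l0 * u)) ≤ ∫ u in S, u * exp (-(V u) + l * u)) :
    0 ≤ ∫ u : ℝ, u * exp (-(V u) + l * u) := by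
  have hi := int_u hV h
  have hi0 := int_u hV h0
  rw [← intervalIntegral.integral_Iic_add_Ioi hi.integrableOn hi.integrableOn (b := 0)]
  have e1 : (∫ u in S, u * exp (-(V u) + l * u)) ≤ ∫ u in Set.Ioi 0, u * exp (-(V u) + l * u) := by
    refine setIntegral_mono_set hi.integrableOn ?_ (Eventually.of_forall hS0)
    refine (ae_restrict_iff' measurableSet_Ioi).2 (ae_of_all _ fun u hu => ?_)
    have hu : 0 < u := hu
    positivity
  have e2 : (∫ u in Set.Iic 0, u * exp (-(V u) + l0 * u)) ≤
      ∫ u in Set.Iic 0, u * exp (-(V u) + l * u) := by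
    refine setIntegral_mono_on hi0.integrableOn hi.integrableOn measurableSet_Iic fun u hu => ?_
    have hu : u ≤ 0 := hu
    refine mul_le_mul_of_nonpos_left (exp_le_exp.2 ?_) hu
    nlinarith
  linarith

lemma convex_slope_bound {V : ℝ → ℝ} (hV : ConvexOn ℝ Set.univ V) {L : ℝ}
    (hp : Tendsto (fun x : ℝ => V x / x) atTop (nhds L)) {u : ℝ} (hu : 0 < u) :
    V u ≤ V 0 + L * u := by
  have h1 : Tendsto (fun x : ℝ => V x / x - V 0 / x) atTop (nhds (L - 0)) :=
    hp.sub (tendsto_const_nhds.div_atTop tendsto_id)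
  rw [sub_zero] at h1
  have h2 : (V u - V 0) / u ≤ L := by
    refine ge_of_tendsto h1 ?_
    filter_upwards [eventually_gt_atTop u] with x hx
    have hx0 : 0 < x := hu.trans hx
    have := hV.secant_mono (a := 0) (x := u) (y := x) (Set.mem_univ _) (Set.mem_univ _)
      (Set.mem_univ _) hu.ne' hx0.ne' hx.le
    simpa [sub_div] using this
  rw [div_le_iff₀ hu] at h2
  linarith

lemma exists_hi {V : ℝ → ℝ} (hV : ConvexOn ℝ Set.univ V) {l0 : ℝ} (h0 : InSlopeInterval V l0) :
    ∃ l, InSlopeInterval V l ∧ l0 ≤ l ∧ 0 ≤ ∫ u : ℝ, u * exp (-(V u) + l * u) := by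
  obtain ⟨vm, vp, hm, hp, h1, h2⟩ := id h0
  have hVc := convex_cont hV
  set K := -(∫ u in Set.Iic 0, u * exp (-(V u) + l0 * u)) with hK
  induction vp using EReal.rec with
  | bot => exact absurd h2 not_lt_bot
  | top =>
    have hsl : ∀ l, l0 ≤ l → InSlopeInterval V l := fun l hl =>
      (slope_iff hm hp l).2 ⟨h1.trans_le (by exact_mod_cast hl), EReal.coe_lt_top l⟩
    have hi : IntegrableOn (fun u => exp (-(V u))) (Set.Icc 1 2) :=
      (Real.continuous_exp.comp hVc.neg).continuousOn.integrableOn_compact isCompact_Icc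
    have hc1 : 0 < ∫ u in Set.Icc (1 : ℝ) 2, exp (-(V u)) := by
      have : NeZero (volume.restrict (Set.Icc (1 : ℝ) 2)) := by
        constructor
        rw [Ne, Measure.restrict_eq_zero]
        norm_num
      exact integral_exp_pos hi
    set c1 := ∫ u in Set.Icc (1 : ℝ) 2, exp (-(V u)) with hc1d
    refine ⟨|l0| + |K| / c1, hsl _ ?_, ?_, ?_⟩
    · have := le_abs_self l0; have : 0 ≤ |K| / c1 := by positivity
      linarith
    · have := le_abs_self l0; have : 0 ≤ |K| / c1 := by positivity
      linarith
    have hle : l0 ≤ |l0| + |K| / c1 := by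
      have := le_abs_self l0; have : 0 ≤ |K| / c1 := by positivity
      linarith
    set l := |l0| + |K| / c1 with hl
    have hlnn : 0 ≤ l := by positivity
    refine piece hV h0 (hsl l hle) hle (S := Set.Icc 1 2) measurableSet_Icc ?_ ?_
    · intro u hu; exact lt_of_lt_of_le one_pos hu.1
    calc K ≤ |K| := le_abs_self K
      _ = |K| / c1 * c1 := by field_simp
      _ ≤ l * c1 := by
        gcongr; rw [hl]; have := abs_nonneg l0; linarith
      _ = ∫ u in Set.Icc (1 : ℝ) 2, l * exp (-(V u)) := by rw [integral_const_mul]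
      _ ≤ _ := by
        refine setIntegral_mono_on (hi.const_mul l) (int_u hV (hsl l hle)).integrableOn
          measurableSet_Icc fun u hu => ?_
        have hu1 : 1 ≤ u := hu.1
        rw [exp_add, mul_comm l, ← mul_assoc, mul_comm u, mul_assoc]
        refine mul_le_mul_of_nonneg_left ?_ (exp_pos _).le
        have := add_one_le_exp (l * u)
        nlinarith [mul_nonneg hlnn (sub_nonneg.2 hu1), exp_pos (l * u)]
  | coe L =>
    have hLl : l0 < L := by exact_mod_cast h2
    have hp' : Tendsto (fun x : ℝ => V x / x) atTop (nhds L) := EReal.tendsto_coe.1 hp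
    set R := 2 + 1 / (L - l0) + |K| * exp (V 0 + 1) with hR
    have hd : 0 < L - l0 := by linarith
    have hR2 : 2 ≤ R := by
      have : 0 ≤ 1 / (L - l0) := by positivity
      have : 0 ≤ |K| * exp (V 0 + 1) := by positivity
      linarith
    have hR3 : 1 / (L - l0) ≤ R := by
      have : 0 ≤ |K| * exp (V 0 + 1) := by positivity
      linarith
    have hR4 : |K| * exp (V 0 + 1) ≤ R := by
      have : 0 ≤ 1 / (L - l0) := by positivity
      linarith
    have hR0 : 0 < R := by linarith
    have hle : l0 ≤ L - 1 / R := by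
      have : 1 / R ≤ L - l0 := by
        rw [one_div_le hR0 hd]; exact hR3
      linarith
    have hlt : L - 1 / R < L := by
      have : 0 < 1 / R := by positivity
      linarith
    have hsl : InSlopeInterval V (L - 1 / R) :=
      (slope_iff hm hp _).2 ⟨h1.trans_le (by exact_mod_cast hle), by exact_mod_cast hlt⟩
    refine ⟨L - 1 / R, hsl, hle, ?_⟩
    refine piece hV h0 hsl hle (S := Set.Ioc 0 R) measurableSet_Ioc (fun u hu => hu.1) ?_
    calc K ≤ |K| := le_abs_self K
      _ = |K| * exp (V 0 + 1) * exp (-(V 0) - 1) := by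
        rw [mul_assoc, ← exp_add, show V 0 + 1 + (-(V 0) - 1) = 0 by ring, exp_zero, mul_one]
      _ ≤ R * exp (-(V 0) - 1) := by gcongr
      _ ≤ (R ^ 2 / 2) * exp (-(V 0) - 1) := by
        gcongr; nlinarith
      _ = ∫ u in Set.Ioc 0 R, u * exp (-(V 0) - 1) := by
        rw [← intervalIntegral.integral_of_le hR0.le, intervalIntegral.integral_mul_const, integral_id]
        ring
      _ ≤ _ := by
        refine setIntegral_mono_on ?_ (int_u hV hsl).integrableOn measurableSet_Ioc fun u hu => ?_
        · exact ((by fun_prop : Continuous fun u : ℝ => u * exp (-(V 0) - 1)).continuousOn.integrableOn_compact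
            (isCompact_Icc (a := 0) (b := R))).mono_set Set.Ioc_subset_Icc_self
        · have hu0 : 0 < u := hu.1
          refine mul_le_mul_of_nonneg_left (exp_le_exp.2 ?_) hu0.le
          have b1 := convex_slope_bound hV hp' hu0
          have b2 : 1 / R * u ≤ 1 := by
            rw [one_div, inv_mul_le_iff₀ hR0, mul_one]; exact hu.2
          nlinarith

lemma inSlope_neg {V : ℝ → ℝ} {l : ℝ} (h : InSlopeInterval V l) :
    InSlopeInterval (fun u => V (-u)) (-l) := by
  obtain ⟨vm, vp, hm, hp, h1, h2⟩ := h
  refine ⟨-vp, -vm, ?_, ?_, ?_, ?_⟩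
  · have := (continuous_neg.tendsto vp).comp (hp.comp tendsto_neg_atBot_atTop)
    refine this.congr fun x => ?_
    simp only [Function.comp]
    rw [← EReal.coe_neg, div_neg, neg_neg]
  · have := (continuous_neg.tendsto vm).comp (hm.comp tendsto_neg_atTop_atBot)
    refine this.congr fun x => ?_
    simp only [Function.comp]
    rw [← EReal.coe_neg, div_neg, neg_neg]
  · rw [EReal.coe_neg]; exact EReal.neg_lt_neg_iff.2 h2
  · rw [EReal.coe_neg]; exact EReal.neg_lt_neg_iff.2 h1

lemma exists_lo {V : ℝ → ℝ} (hV : ConvexOn ℝ Set.univ V) {l0 : ℝ} (h0 : InSlopeInterval V l0) :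
    ∃ l, InSlopeInterval V l ∧ l ≤ l0 ∧ (∫ u : ℝ, u * exp (-(V u) + l * u)) ≤ 0 := by
  have hV' : ConvexOn ℝ Set.univ fun u => V (-u) := by
    refine ⟨convex_univ, fun x _ y _ s t hs ht hst => ?_⟩
    have := hV.2 (Set.mem_univ (-x)) (Set.mem_univ (-y)) hs ht hst
    simp only [smul_eq_mul] at *
    rwa [show -(s * x + t * y) = s * -x + t * -y by ring]
  obtain ⟨l, h1, h2, h3⟩ := exists_hi hV' (inSlope_neg h0)
  refine ⟨-l, ?_, by linarith, ?_⟩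
  · have := inSlope_neg h1
    simpa using this
  · rw [← integral_neg_eq_self]
    have : (fun u : ℝ => -u * exp (-(V (-u)) + -l * -u)) =
        fun u => -(u * exp (-(V (-u)) + l * u)) := by
      funext u; rw [neg_mul]; congr 4; ring
    rw [this, integral_neg]
    linarith

lemma exists_lam {V : ℝ → ℝ} (hV : InClassC V) : ∃ l, InSlopeInterval V l ∧
    (∫ u : ℝ, u * exp (-(V u) + l * u)) = 0 := by
  have hc := hV.convex
  have hVc := convex_cont hc
  obtain ⟨vm, vp, hm, hp, hlt⟩ := hV.slopes
  obtain ⟨l0, ha, hb⟩ := EReal.lt_iff_exists_real_btwn.1 hlt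
  have h0 : InSlopeInterval V l0 := (slope_iff hm hp l0).2 ⟨ha, hb⟩
  obtain ⟨l1, hs1, hle1, hv1⟩ := exists_lo hc h0
  obtain ⟨l2, hs2, hle2, hv2⟩ := exists_hi hc h0
  have hcont : ContinuousOn (fun l : ℝ => ∫ u : ℝ, u * exp (-(V u) + l * u)) (Set.Icc l1 l2) := by
    refine continuousOn_of_dominated (bound := fun u => |u * exp (-(V u) + l1 * u)| + |u * exp (-(V u) + l2 * u)|)
      ?_ ?_ ((int_u hc hs1).abs.add (int_u hc hs2).abs) ?_
    · intro l _
      exact (by fun_prop : Continuous fun u => u * exp (-(V u) + l * u)).aestronglyMeasurable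
    · intro l hl
      refine ae_of_all _ fun u => ?_
      simp only [Real.norm_eq_abs, abs_mul, abs_exp]
      rw [← mul_add]
      refine mul_le_mul_of_nonneg_left ?_ (abs_nonneg u)
      rcases le_total 0 u with h | h
      · have : exp (-(V u) + l * u) ≤ exp (-(V u) + l2 * u) := exp_le_exp.2 (by nlinarith [hl.2])
        linarith [exp_pos (-(V u) + l1 * u)]
      · have : exp (-(V u) + l * u) ≤ exp (-(V u) + l1 * u) := exp_le_exp.2 (by nlinarith [hl.1])
        linarith [exp_pos (-(V u) + l2 * u)]
    · exact ae_of_all _ fun u => by fun_prop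
  obtain ⟨l, hl, hl0⟩ := intermediate_value_Icc (hle1.trans hle2) hcont ⟨hv1, hv2⟩
  refine ⟨l, ?_, hl0⟩
  have a1 := (slope_iff hm hp l1).1 hs1
  have a2 := (slope_iff hm hp l2).1 hs2
  exact (slope_iff hm hp l).2 ⟨a1.1.trans_le (by exact_mod_cast hl.1),
    lt_of_le_of_lt (by exact_mod_cast hl.2) a2.2⟩

/-- **Comparison with a product measure.** For `V ∈ 𝒞` there is a unique `λ ∈ (V'_-, V'_+)` with
`∫ u e^{-V(u)+λu} du = 0`; set `Ṽ = V - λ·id` and let `ν_N` be the law of `N` i.i.d. variables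
with density `∝ e^{-Ṽ}`. For every `a ∈ (0,1)` there is `C_a > 0` such that for all `N ≥ 1` and
all bounded measurable `f ≥ 0` depending only on the first `N_a = ⌊aN⌋` increments,
`E_{π_N}[f(η_1,…,η_{N_a})] ≤ C_a E_{ν_N}[f(η_1,…,η_{N_a})]`. -/
theorem comparison_with_product_measure (V : ℝ → ℝ) (hV : InClassC V)
    (a : ℝ) (ha0 : 0 < a) (ha1 : a < 1) :
    (∃! lam : ℝ, InSlopeInterval V lam ∧
      (∫ u : ℝ, u * Real.exp (-(V u) + lam * u)) = 0) ∧
    ∀ lam : ℝ, InSlopeInterval V lam →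
      (∫ u : ℝ, u * Real.exp (-(V u) + lam * u)) = 0 →
      ∃ Ca > (0 : ℝ), ∀ N : ℕ, 1 ≤ N →
        ∀ f : (Fin N → ℝ) → ℝ, Measurable f → (∀ η, 0 ≤ f η) → (∃ M : ℝ, ∀ η, f η ≤ M) →
          (∀ η η' : Fin N → ℝ, (∀ k : Fin N, (k : ℕ) < Nat.floor (a * N) → η k = η' k) →
            f η = f η') →
          (∫ x, f (incr N x) ∂piN V N) ≤ Ca * ∫ η, f η ∂nuN V lam N := by
  refine ⟨?_, ?_⟩
  · obtain ⟨l, hl, hl0⟩ := exists_lam hV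
    refine ⟨l, ⟨hl, hl0⟩, ?_⟩
    rintro l' ⟨hl', hl0'⟩
    rcases lt_trichotomy l' l with h | h | h
    · have := mean_strict hV.convex hl' hl h
      rw [hl0, hl0'] at this
      exact absurd this (lt_irrefl _)
    · exact h
    · have := mean_strict hV.convex hl hl' h
      rw [hl0, hl0'] at this
      exact absurd this (lt_irrefl _)
  · intro lam hl hl0
    obtain ⟨hz, hp⟩ := good_of_slope hV.convex hl hl0
    exact hp.compare V lam _ hz (fun _ => rfl) a ha0 ha1

end
end
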